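/- arXiv:1310.1896 — 2 statements merged into one kernel-verified Lean document; each statement's English description precedes it below -/
import Mathlib

section
/- For every connected cubic simple graph G there exists a tour of length at most (4/3 − 1/183711)·SUB(G), where SUB(G) denotes the optimal value of the subtour linear programming relaxation of G. -/
open SimpleGraph

namespace CubicTour

set_option linter.unusedSectionVars false

variable {V : Type*} [DecidableEq V]

/-- Double sum of a weight over a product of two vertex sets. -/
def dsum {M : Type*} [AddCommMonoid M] (f : V → V → M) (A B : Finset V) : M :=
  ∑ a ∈ A, ∑ b ∈ B, f a b

lemma dsum_union_left {M : Type*} [AddCommMonoid M] (f : V → V → M) {A B : Finset V}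
    (C : Finset V) (h : Disjoint A B) : dsum f (A ∪ B) C = dsum f A C + dsum f B C := by
  unfold dsum; rw [Finset.sum_union h]

lemma dsum_union_right {M : Type*} [AddCommMonoid M] (f : V → V → M) {A B : Finset V}
    (C : Finset V) (h : Disjoint A B) : dsum f C (A ∪ B) = dsum f C A + dsum f C B := by
  unfold dsum
  rw [← Finset.sum_add_distrib]
  exact Finset.sum_congr rfl fun c _ => Finset.sum_union h

lemma dsum_comm {M : Type*} [AddCommMonoid M] (f : V → V → M) (hf : ∀ a b, f a b = f b a)
    (A B : Finset V) : dsum f A B = dsum f B A := by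
  unfold dsum
  rw [Finset.sum_comm]
  exact Finset.sum_congr rfl fun b _ => Finset.sum_congr rfl fun a _ => hf a b

open Classical in
/-- Number of (ordered) adjacent pairs between two vertex sets. -/
noncomputable def ee (H : SimpleGraph V) (A B : Finset V) : ℤ :=
  dsum (fun a b => if H.Adj a b then (1 : ℤ) else 0) A B

variable {H : SimpleGraph V}

lemma ee_union_left {A B : Finset V} (C : Finset V) (h : Disjoint A B) :
    ee H (A ∪ B) C = ee H A C + ee H B C := dsum_union_left _ C h

lemma ee_union_right {A B : Finset V} (C : Finset V) (h : Disjoint A B) :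
    ee H C (A ∪ B) = ee H C A + ee H C B := dsum_union_right _ C h

lemma ee_comm (A B : Finset V) : ee H A B = ee H B A :=
  dsum_comm _ (fun a b => by
    by_cases h : H.Adj a b
    · simp [h, h.symm]
    · have h' : ¬ H.Adj b a := fun k => h k.symm
      simp [h, h']) A B

lemma ee_nonneg (A B : Finset V) : 0 ≤ ee H A B := by
  unfold ee dsum
  refine Finset.sum_nonneg fun a _ => Finset.sum_nonneg fun b _ => ?_
  dsimp only
  split_ifs <;> norm_num

lemma ee_split_right {A B : Finset V} (C : Finset V) (h : A ⊆ B) :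
    ee H C B = ee H C A + ee H C (B \ A) := by
  rw [← ee_union_right C Finset.disjoint_sdiff, Finset.union_sdiff_of_subset h]

lemma ee_mono_right {A B : Finset V} (C : Finset V) (h : A ⊆ B) : ee H C A ≤ ee H C B := by
  rw [ee_split_right C h]; linarith [ee_nonneg (H := H) C (B \ A)]

lemma ee_mono_left {A B : Finset V} (C : Finset V) (h : A ⊆ B) : ee H A C ≤ ee H B C := by
  rw [ee_comm A, ee_comm B]; exact ee_mono_right C h

lemma ee_single {a b : V} (h : H.Adj a b) : ee H {a} {b} = 1 := by
  unfold ee dsum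
  rw [Finset.sum_singleton, Finset.sum_singleton]
  exact if_pos h

lemma ee_self (a : V) : ee H {a} {a} = 0 := by
  simp [ee, dsum]

lemma ee_zero {A B : Finset V} (h : ∀ a ∈ A, ∀ b ∈ B, ¬ H.Adj a b) : ee H A B = 0 := by
  unfold ee dsum
  refine Finset.sum_eq_zero fun a ha => Finset.sum_eq_zero fun b hb => ?_
  simp [h a ha b hb]

lemma ee_pos {A B : Finset V} {a b : V} (ha : a ∈ A) (hb : b ∈ B) (h : H.Adj a b) :
    1 ≤ ee H A B := by
  rw [← ee_single h]
  exact (ee_mono_right _ (by simpa using hb)).trans (ee_mono_left _ (by simpa using ha))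

lemma exists_of_ee_pos {A B : Finset V} (h : 1 ≤ ee H A B) :
    ∃ a ∈ A, ∃ b ∈ B, H.Adj a b := by
  by_contra hc
  push Not at hc
  rw [ee_zero hc] at h
  omega

/-- If exactly one edge runs between `A` and `B`. -/
lemma ee_one {A B : Finset V} (h : ee H A B = 1) :
    ∃ c ∈ A, ∃ d ∈ B, H.Adj c d ∧ (∀ a ∈ A, ∀ b ∈ B, H.Adj a b → a = c ∧ b = d) := by
  obtain ⟨c, hc, d, hd, hcd⟩ := exists_of_ee_pos h.ge
  refine ⟨c, hc, d, hd, hcd, fun a ha b hb hab => ?_⟩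
  have hA : A = {c} ∪ (A \ {c}) := by
    rw [Finset.union_sdiff_of_subset]; simpa using hc
  have hB : B = {d} ∪ (B \ {d}) := by
    rw [Finset.union_sdiff_of_subset]; simpa using hd
  have h1 : ee H A B = ee H {c} B + ee H (A \ {c}) B := by
    conv_lhs => rw [hA]
    exact ee_union_left _ Finset.disjoint_sdiff
  have h2 : ee H {c} B = ee H {c} {d} + ee H {c} (B \ {d}) :=
    ee_split_right _ (by simpa using hd)
  rw [ee_single hcd] at h2
  have n1 := ee_nonneg (H := H) (A \ {c}) B
  have n2 := ee_nonneg (H := H) {c} (B \ {d})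
  have hac : a = c := by
    by_contra hne
    have := ee_pos (H := H) (A := A \ {c}) (B := B) (by simp [ha, hne]) hb hab
    omega
  subst hac
  refine ⟨rfl, ?_⟩
  by_contra hne
  have := ee_pos (H := H) (A := {a}) (B := B \ {d}) (by simp) (by simp [hb, hne]) hab
  omega

/-- Potential. -/
noncomputable def Phi (H : SimpleGraph V) (S : Finset V) : ℤ := 36 * S.card - 5 * ee H S S

lemma Phi_union {A B : Finset V} (h : Disjoint A B) :
    Phi H (A ∪ B) = Phi H A + Phi H B - 10 * ee H A B := by
  unfold Phi
  rw [Finset.card_union_of_disjoint h, ee_union_left _ h, ee_union_right _ h, ee_union_right _ h,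
    ee_comm B A]
  push_cast; ring

lemma Phi_single (a : V) : Phi H {a} = 36 := by
  simp [Phi, ee_self]

/-- A walk from `a` to `b` whose vertex set is `S`, using each edge at most twice. -/
def Tr (H : SimpleGraph V) (S : Finset V) (a b : V) (l : ℕ) : Prop :=
  ∃ w : H.Walk a b, (∀ v, v ∈ w.support ↔ v ∈ S) ∧ (∀ e, w.edges.count e ≤ 2) ∧ w.length = l

lemma Tr.single (a : V) : Tr H {a} a a 0 :=
  ⟨Walk.nil, by simp, by simp, rfl⟩

lemma Tr.symm {S : Finset V} {a b : V} {l : ℕ} (h : Tr H S a b l) : Tr H S b a l := by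
  obtain ⟨w, h1, h2, h3⟩ := h
  refine ⟨w.reverse, by simpa using h1, fun e => ?_, by simpa using h3⟩
  rw [Walk.edges_reverse, List.count_reverse]; exact h2 e

lemma Tr.cast {S S' : Finset V} {a b : V} {l l' : ℕ} (h : Tr H S a b l) (hS : S = S')
    (hl : l = l') : Tr H S' a b l' := by subst hS; subst hl; exact h

lemma Tr.left_mem {S : Finset V} {a b : V} {l : ℕ} (h : Tr H S a b l) : a ∈ S := by
  obtain ⟨w, h1, _⟩ := h
  exact (h1 a).1 w.start_mem_support

lemma Tr.right_mem {S : Finset V} {a b : V} {l : ℕ} (h : Tr H S a b l) : b ∈ S := h.symm.left_mem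

lemma count_zero_of {a b u v : V} (w : H.Walk a b) (h : u ∉ w.support) :
    w.edges.count s(u, v) = 0 :=
  List.count_eq_zero_of_not_mem fun hm => h (w.fst_mem_support_of_mem_edges hm)

lemma count_zero_of' {a b u v : V} (w : H.Walk a b) (h : v ∉ w.support) :
    w.edges.count s(u, v) = 0 :=
  List.count_eq_zero_of_not_mem fun hm => h (w.snd_mem_support_of_mem_edges hm)

lemma Tr.series {S T : Finset V} {a b c d : V} {l m : ℕ} (h : Tr H S a b l) (h' : Tr H T c d m)
    (hadj : H.Adj b c) (hd : Disjoint S T) : Tr H (S ∪ T) a d (l + m + 1) := by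
  have hb := h.right_mem
  have hc := h'.left_mem
  obtain ⟨w, h1, h2, h3⟩ := h
  obtain ⟨w', h1', h2', h3'⟩ := h'
  refine ⟨w.append (Walk.cons hadj w'), fun v => ?_, fun e => ?_, ?_⟩
  · rw [Walk.mem_support_append_iff, Walk.support_cons, List.mem_cons, h1, h1', Finset.mem_union]
    constructor
    · rintro (h | rfl | h) <;> tauto
    · tauto
  · induction e with | _ u v
    rw [Walk.edges_append, Walk.edges_cons, List.count_append, List.count_cons]
    have hw : ∀ x, x ∈ S → x ∉ T := fun x hx hx' => (Finset.disjoint_left.1 hd) hx hx'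
    have key : ∀ u v, u ∈ S → v ∈ S → w'.edges.count s(u, v) = 0 ∧ (s(b, c) ≠ s(u, v)) := by
      intro u v hu hv
      refine ⟨count_zero_of _ (by rw [h1']; exact hw u hu), ?_⟩
      intro he
      have : c ∈ s(u, v) := by rw [← he]; simp
      rw [Sym2.mem_iff] at this
      rcases this with rfl | rfl
      · exact hw _ hu hc
      · exact hw _ hv hc
    by_cases hin : u ∈ S ∧ v ∈ S
    · obtain ⟨k1, k2⟩ := key u v hin.1 hin.2
      rw [k1]
      have := h2 s(u, v)
      simp [k2]; exact this
    · have k1 : w.edges.count s(u, v) = 0 := by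
        by_cases hu : u ∈ S
        · exact count_zero_of' _ (by rw [h1]; tauto)
        · exact count_zero_of _ (by rw [h1]; tauto)
      rw [k1]
      by_cases he : s(b, c) = s(u, v)
      · have k2 : w'.edges.count s(u, v) = 0 := by
          rw [← he]
          exact count_zero_of _ (by rw [h1']; exact hw b hb)
        rw [k2]; split_ifs <;> omega
      · have := h2' s(u, v)
        simp [he]; exact this
  · simp [h3, h3']; omega

lemma Tr.rot {S : Finset V} {a b : V} {l : ℕ} (h : Tr H S a a l) (hb : b ∈ S) : Tr H S b b l := by
  obtain ⟨w, h1, h2, h3⟩ := h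
  have hb' : b ∈ w.support := (h1 b).2 hb
  refine ⟨w.rotate b hb', fun v => ?_, fun e => ?_, ?_⟩
  · rw [Walk.mem_support_rotate_iff, h1]
  · rw [(w.rotate_edges b hb').perm.count_eq]; exact h2 e
  · rw [Walk.length_rotate, h3]

lemma Tr.attach {S T : Finset V} {a b u c z : V} {l m : ℕ} (h : Tr H S a b l)
    (h' : Tr H T z z m) (hu : u ∈ S) (hc : c ∈ T)
    (hadj : H.Adj u c) (hd : Disjoint S T) : Tr H (S ∪ T) a b (l + m + 2) := by
  have h' := h'.rot hc
  obtain ⟨w, h1, h2, h3⟩ := h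
  obtain ⟨w', h1', h2', h3'⟩ := h'
  have hu' : u ∈ w.support := (h1 u).2 hu
  have hspec := w.take_spec hu'
  have hw : ∀ x, x ∈ S → x ∉ T := fun x hx hx' => (Finset.disjoint_left.1 hd) hx hx'
  refine ⟨(w.takeUntil u hu').append
    ((Walk.cons hadj (w'.append (Walk.cons hadj.symm Walk.nil))).append (w.dropUntil u hu')),
    fun v => ?_, fun e => ?_, ?_⟩
  · have : v ∈ S ↔ v ∈ (w.takeUntil u hu').support ∨ v ∈ (w.dropUntil u hu').support := by
      rw [← h1, ← Walk.mem_support_append_iff, hspec]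
    rw [Finset.mem_union, this]
    simp only [Walk.mem_support_append_iff, Walk.support_cons, List.mem_cons, h1',
      Walk.support_nil, List.not_mem_nil, or_false]
    have hus : u ∈ (w.takeUntil u hu').support := Walk.end_mem_support _
    constructor
    · rintro (h | (rfl | (h | rfl | rfl)) | h) <;> tauto
    · tauto
  · have hcnt : w.edges.count e = (w.takeUntil u hu').edges.count e
        + (w.dropUntil u hu').edges.count e := by
      rw [← List.count_append, ← Walk.edges_append, hspec]
    have hgoal : ((w.takeUntil u hu').append
      ((Walk.cons hadj (w'.append (Walk.cons hadj.symm Walk.nil))).append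
        (w.dropUntil u hu'))).edges.count e
        = w.edges.count e + w'.edges.count e + (if s(u, c) = e then 2 else 0) := by
      rw [hcnt]
      simp only [Walk.edges_append, Walk.edges_cons, Walk.edges_nil, List.count_append,
        List.count_cons, List.count_nil, Sym2.eq_swap (a := c) (b := u), beq_iff_eq]
      split_ifs <;> omega
    rw [hgoal]
    have b1 := h2 e
    have b2 := h2' e
    induction e with | _ p q
    by_cases he : s(u, c) = s(p, q)
    · rw [if_pos he]
      have : w.edges.count s(p, q) = 0 := by
        rw [← he]; exact count_zero_of' _ (by rw [h1]; exact fun h => hw _ h hc)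
      have : w'.edges.count s(p, q) = 0 := by
        rw [← he]; exact count_zero_of _ (by rw [h1']; exact hw _ hu)
      omega
    · rw [if_neg he]
      by_cases hp : p ∈ S
      · have : w'.edges.count s(p, q) = 0 := count_zero_of _ (by rw [h1']; exact hw _ hp)
        omega
      · have : w.edges.count s(p, q) = 0 := count_zero_of _ (by rw [h1]; exact hp)
        omega
  · have : w.length = (w.takeUntil u hu').length + (w.dropUntil u hu').length := by
      rw [← Walk.length_append, hspec]
    simp only [Walk.length_append, Walk.length_cons, Walk.length_nil, h3']
    omega

lemma Tr.cons {S : Finset V} {x a b : V} {l : ℕ} (h : Tr H S a b l) (hx : x ∉ S)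
    (hadj : H.Adj x a) : Tr H ({x} ∪ S) x b (l + 1) :=
  ((Tr.single x).series h hadj (by simpa using hx)).cast rfl (by omega)

lemma Tr.close {S : Finset V} {x a b : V} {l : ℕ} (h : Tr H S a b l) (hx : x ∉ S)
    (hadj : H.Adj x a) (hadj' : H.Adj x b) : Tr H ({x} ∪ S) x x (l + 2) := by
  obtain ⟨w, h1, h2, h3⟩ := h
  refine ⟨Walk.cons hadj (w.append (Walk.cons hadj'.symm Walk.nil)), fun v => ?_, fun e => ?_, ?_⟩
  · simp only [Walk.mem_support_append_iff, Walk.support_cons, List.mem_cons, h1,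
      Walk.support_nil, List.not_mem_nil, or_false, Finset.mem_union, Finset.mem_singleton]
    have hb : b ∈ S := (h1 b).1 w.end_mem_support
    constructor
    · rintro (h | h | rfl | h) <;> tauto
    · tauto
  · simp only [Walk.edges_append, Walk.edges_cons, Walk.edges_nil, List.count_append,
        List.count_cons, List.count_nil, beq_iff_eq]
    have b1 := h2 e
    induction e with | _ p q
    by_cases hpq : x = p ∨ x = q
    · have : w.edges.count s(p, q) = 0 := by
        rcases hpq with rfl | rfl
        · exact count_zero_of _ (by rw [h1]; exact hx)
        · exact count_zero_of' _ (by rw [h1]; exact hx)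
      split_ifs <;> omega
    · have e1 : s(x, a) ≠ s(p, q) := by
        intro he
        have : x ∈ s(p, q) := by rw [← he]; simp
        rw [Sym2.mem_iff] at this; exact hpq this
      have e2 : s(b, x) ≠ s(p, q) := by
        intro he
        have : x ∈ s(p, q) := by rw [← he]; simp
        rw [Sym2.mem_iff] at this; exact hpq this
      rw [if_neg e1, if_neg e2]; omega
  · simp [h3]


/-- No cut with fewer than two edges. -/
def Bless (H : SimpleGraph V) (S : Finset V) : Prop :=
  ∀ T, T ⊆ S → T.Nonempty → T ≠ S → 2 ≤ ee H T (S \ T)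

/-- Two-edge-connected after adding an edge between `a` and `b`. -/
def CutChain (H : SimpleGraph V) (S : Finset V) (a b : V) : Prop :=
  a ∈ S ∧ b ∈ S ∧ ee H {a} S ≤ 2 ∧ ee H {b} S ≤ 2 ∧ (a = b → S = {a}) ∧
    ∀ T, T ⊆ S → T.Nonempty → T ≠ S →
      2 ≤ ee H T (S \ T) + (if a ∈ T ↔ b ∈ T then 0 else 1)

/-- A single vertex, or a bridgeless set with two terminals. -/
def Blk (H : SimpleGraph V) (Q : Finset V) (a b : V) : Prop :=
  (Q = {a} ∧ a = b) ∨
    (Bless H Q ∧ a ∈ Q ∧ b ∈ Q ∧ a ≠ b ∧ ee H {a} Q ≤ 2 ∧ ee H {b} Q ≤ 2)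

/-- Chains of blocks. -/
inductive Ch (H : SimpleGraph V) : Finset V → V → V → Prop
  | blk {Q : Finset V} {a b : V} (h : Blk H Q a b) : Ch H Q a b
  | join {A B : Finset V} {a b c d : V} (hA : Ch H A a c) (hB : Ch H B d b)
      (hd : Disjoint A B) (hadj : H.Adj c d) (he : ee H A B = 1) : Ch H (A ∪ B) a b

lemma Blk.symm {Q : Finset V} {a b : V} (h : Blk H Q a b) : Blk H Q b a := by
  rcases h with ⟨rfl, rfl⟩ | ⟨h1, h2, h3, h4, h5, h6⟩
  · exact Or.inl ⟨rfl, rfl⟩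
  · exact Or.inr ⟨h1, h3, h2, h4.symm, h6, h5⟩

lemma Blk.left_mem {Q : Finset V} {a b : V} (h : Blk H Q a b) : a ∈ Q := by
  rcases h with ⟨rfl, rfl⟩ | ⟨h1, h2, h3, h4, h5, h6⟩
  · simp
  · exact h2

lemma Ch.symm {S : Finset V} {a b : V} (h : Ch H S a b) : Ch H S b a := by
  induction h with
  | blk h => exact Ch.blk h.symm
  | join hA hB hd hadj he ihA ihB =>
    rw [Finset.union_comm]
    exact Ch.join ihB ihA hd.symm hadj.symm (by rw [ee_comm]; exact he)

lemma Ch.left_mem {S : Finset V} {a b : V} (h : Ch H S a b) : a ∈ S := by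
  induction h with
  | blk h => exact h.left_mem
  | join hA hB hd hadj he ihA ihB => exact Finset.mem_union_left _ ihA

lemma Ch.right_mem {S : Finset V} {a b : V} (h : Ch H S a b) : b ∈ S := h.symm.left_mem

lemma CutChain.symm {S : Finset V} {a b : V} (h : CutChain H S a b) : CutChain H S b a := by
  obtain ⟨h1, h2, h3, h4, h5, h6⟩ := h
  refine ⟨h2, h1, h4, h3, fun h => by rw [h5 h.symm, h], fun T t1 t2 t3 => ?_⟩
  have := h6 T t1 t2 t3
  simp only [iff_comm (a := b ∈ T)]
  exact this

/-- Every vertex has at most three neighbours. -/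
def Sub3 (H : SimpleGraph V) : Prop := ∀ (v : V) (S : Finset V), ee H {v} S ≤ 3

lemma deg_out1 (h3 : Sub3 H) {z u : V} {L : Finset V} (hu : u ∉ L) (hz : H.Adj z u) :
    ee H {z} L ≤ 2 := by
  have h := h3 z (L ∪ {u})
  rw [ee_union_right _ (by simpa using hu), ee_single hz] at h
  omega

lemma deg_out2 (h3 : Sub3 H) {z u v : V} {L : Finset V} (hu : u ∉ L) (hz : H.Adj z u)
    (hv : v ∉ L) (hz' : H.Adj z v) (huv : u ≠ v) : ee H {z} L ≤ 1 := by
  have h := h3 z (L ∪ {u} ∪ {v})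
  rw [ee_union_right _ (by simp; tauto), ee_union_right _ (by simpa using hu),
    ee_single hz, ee_single hz'] at h
  omega

lemma deg_less {z u : V} {L S : Finset V} (hL : L ⊆ S) (hu : u ∉ L) (huS : u ∈ S)
    (hz : H.Adj z u) : ee H {z} L + 1 ≤ ee H {z} S := by
  have h : L ∪ {u} ⊆ S := Finset.union_subset hL (by simpa using huS)
  have := ee_mono_right (H := H) {z} h
  rw [ee_union_right _ (by simpa using hu), ee_single hz] at this
  omega

lemma compl_cut {S T : Finset V} (h : T ⊆ S) : ee H (S \ T) (S \ (S \ T)) = ee H T (S \ T) := by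
  rw [Finset.sdiff_sdiff_eq_self h, ee_comm]

/-- A cut of a chain by one edge leaves chains. -/
lemma CutChain.left (h3 : Sub3 H) {S T : Finset V} {a b c d : V} (h : CutChain H S a b)
    (hT : T ⊆ S) (haT : a ∈ T) (hbT : b ∉ T) (hc : c ∈ T) (hd : d ∈ S \ T) (hcd : H.Adj c d)
    (huniq : ∀ p ∈ T, ∀ q ∈ S \ T, H.Adj p q → p = c ∧ q = d) : CutChain H T a c := by
  obtain ⟨h1, h2, h3', h4, h5, h6⟩ := h
  have hd' := Finset.mem_sdiff.1 hd
  -- cut condition for sets avoiding at least one terminal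
  have base : ∀ U, U ⊆ T → U.Nonempty → ¬ (a ∈ U ∧ c ∈ U) →
      2 ≤ ee H U (T \ U) + (if a ∈ U ↔ c ∈ U then 0 else 1) := by
    intro U hU hne hn
    have hUS : U ≠ S := by rintro rfl; exact hbT (hU h2)
    have hb : b ∉ U := fun h => hbT (hU h)
    have := h6 U (hU.trans hT) hne hUS
    have hsplit : S \ U = (T \ U) ∪ (S \ T) := by
      ext v; simp only [Finset.mem_sdiff, Finset.mem_union]
      have := @hT v; have := @hU v; tauto
    have hdis : Disjoint (T \ U) (S \ T) := by
      rw [Finset.disjoint_left]; intro v; simp only [Finset.mem_sdiff]; tauto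
    rw [hsplit, ee_union_right _ hdis] at this
    have hx : ee H U (S \ T) ≤ if c ∈ U then 1 else 0 := by
      split_ifs with hcU
      · have hUc : U = {c} ∪ (U \ {c}) := by
          rw [Finset.union_sdiff_of_subset]; simpa using hcU
        rw [hUc, ee_union_left _ Finset.disjoint_sdiff]
        have z1 : ee H (U \ {c}) (S \ T) = 0 := ee_zero fun p hp q hq hpq => by
          have := (huniq p (hU (Finset.mem_sdiff.1 hp).1) q hq hpq).1
          simp [this] at hp
        have z2 : ee H {c} ((S \ T) \ {d}) = 0 := ee_zero fun p hp q hq hpq => by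
          have hq' := Finset.mem_sdiff.1 hq
          rw [Finset.mem_singleton] at hp; subst hp
          have := (huniq p hc q hq'.1 hpq).2
          simp [this] at hq'
        have z3 := ee_split_right (H := H) (A := {d}) (B := S \ T) {c} (by simpa using hd)
        rw [z1, z3, z2, ee_single hcd]; norm_num
      · exact (ee_zero fun p hp q hq hpq => by
          have := (huniq p (hU hp) q hq hpq).1
          subst this; exact hcU hp).le
    by_cases ha : a ∈ U <;> by_cases hcU : c ∈ U <;> simp_all <;> omega
  have cut : ∀ U, U ⊆ T → U.Nonempty → U ≠ T →
      2 ≤ ee H U (T \ U) + (if a ∈ U ↔ c ∈ U then 0 else 1) := by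
    intro U hU hne hUT
    by_cases hn : a ∈ U ∧ c ∈ U
    · have hne' : (T \ U).Nonempty := by
        rw [Finset.sdiff_nonempty]; exact fun h => hUT (hU.antisymm h)
      have := base (T \ U) Finset.sdiff_subset hne' (by simp [hn.1])
      rw [compl_cut hU] at this
      simpa [hn.1, hn.2, haT, hc] using this
    · exact base U hU hne hn
  refine ⟨haT, hc, (ee_mono_right _ hT).trans h3', deg_out1 h3 hd'.2 hcd, ?_, cut⟩
  intro hac
  subst hac
  by_contra hne
  have h := cut {a} (by simpa using haT) (by simp) (fun h => hne h.symm)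
  have k1 := deg_less hT hd'.2 hd'.1 hcd
  have k2 := ee_mono_right (H := H) (A := T \ {a}) (B := T) {a} Finset.sdiff_subset
  simp at h
  omega

lemma CutChain.ch (h3 : Sub3 H) : ∀ (n : ℕ) {S : Finset V} {a b : V}, S.card ≤ n →
    CutChain H S a b → Ch H S a b := by
  intro n
  induction n with
  | zero =>
    intro S a b hn h
    have : S = ∅ := by simpa using hn
    rw [this] at h
    simpa using h.1
  | succ n ih =>
    intro S a b hn h
    by_cases hab : a = b
    · exact Ch.blk (Or.inl ⟨h.2.2.2.2.1 hab, hab⟩)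
    by_cases hB : Bless H S
    · exact Ch.blk (Or.inr ⟨hB, h.1, h.2.1, hab, h.2.2.1, h.2.2.2.1⟩)
    -- a bridge
    have main : ∀ {a b : V} {T : Finset V}, CutChain H S a b → T ⊆ S → a ∈ T → b ∉ T →
        ee H T (S \ T) = 1 → Ch H S a b := by
      intro a b T h hT ha hb he
      obtain ⟨c, hc, d, hd, hcd, hu⟩ := ee_one he
      have hd' := Finset.mem_sdiff.1 hd
      have hbS : b ∈ S \ T := Finset.mem_sdiff.2 ⟨h.2.1, hb⟩
      have c1 := h.left h3 hT ha hb hc hd hcd hu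
      have c2 := h.symm.left h3 (T := S \ T) Finset.sdiff_subset hbS (by simp [ha]) hd
        (by rw [Finset.sdiff_sdiff_eq_self hT]; exact hc) hcd.symm
        (by
          rw [Finset.sdiff_sdiff_eq_self hT]
          intro p hp q hq hpq
          exact (hu q hq p hp hpq.symm).symm)
      have l1 : T.card < S.card :=
        Finset.card_lt_card ⟨hT, fun h' => hb (h' h.2.1)⟩
      have l2 : (S \ T).card < S.card :=
        Finset.card_lt_card ⟨Finset.sdiff_subset, fun h' => by
          have := h' h.1; simp [ha] at this⟩
      have := Ch.join (ih (by omega) c1) (ih (by omega) c2).symm Finset.disjoint_sdiff hcd he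
      rwa [Finset.union_sdiff_of_subset hT] at this
    unfold Bless at hB
    push Not at hB
    obtain ⟨T, hT, hne, hTS, hlt⟩ := hB
    have h6 := h.2.2.2.2.2 T hT hne hTS
    have hiff : ¬ (a ∈ T ↔ b ∈ T) := by
      intro hc; rw [if_pos hc] at h6; omega
    rw [if_neg hiff] at h6
    by_cases ha : a ∈ T
    · exact main h hT ha (by tauto) (by omega)
    · exact (main h.symm hT (by tauto) ha (by omega)).symm

/-- Position of a vertex `y` inside a chain. -/
def Mid (H : SimpleGraph V) (y : V) (Q : Finset V) (a b : V) : Prop :=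
  Blk H Q a b ∧ Blk H Q y a ∧ Blk H Q y b

inductive Peel (H : SimpleGraph V) (y : V) : Finset V → V → V → Prop
  | mid {Q : Finset V} {a b : V} (h : Mid H y Q a b) : Peel H y Q a b
  | rt {Q R : Finset V} {a q r b : V} (h : Mid H y Q a q) (hR : Ch H R r b) (hadj : H.Adj q r)
      (hd : Disjoint Q R) (he : ee H Q R = 1) : Peel H y (Q ∪ R) a b
  | lf {L Q : Finset V} {a l q b : V} (hL : Ch H L a l) (h : Mid H y Q q b) (hadj : H.Adj l q)
      (hd : Disjoint L Q) (he : ee H L Q = 1) : Peel H y (L ∪ Q) a b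
  | both {L Q R : Finset V} {a l q q' r b : V} (hL : Ch H L a l) (h : Mid H y Q q q')
      (hR : Ch H R r b) (hadj : H.Adj l q) (hadj' : H.Adj q' r)
      (hd : Disjoint L Q) (hd' : Disjoint Q R) (hd'' : Disjoint L R) (he : ee H L Q = 1)
      (he' : ee H Q R = 1) (he'' : ee H L R = 0) : Peel H y (L ∪ Q ∪ R) a b

lemma Mid.symm {y : V} {Q : Finset V} {a b : V} (h : Mid H y Q a b) : Mid H y Q b a :=
  ⟨h.1.symm, h.2.2, h.2.1⟩

lemma Peel.symm {y : V} {S : Finset V} {a b : V} (h : Peel H y S a b) : Peel H y S b a := by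
  cases h with
  | mid h => exact Peel.mid h.symm
  | rt h hR hadj hd he =>
    rw [Finset.union_comm]
    exact Peel.lf hR.symm h.symm hadj.symm hd.symm (by rw [ee_comm]; exact he)
  | lf hL h hadj hd he =>
    rw [Finset.union_comm]
    exact Peel.rt h.symm hL.symm hadj.symm hd.symm (by rw [ee_comm]; exact he)
  | @both L Q R _ _ _ _ _ _ hL h hR hadj hadj' hd hd' hd'' he he' he'' =>
    have : L ∪ Q ∪ R = R ∪ Q ∪ L := by
      ext v; simp only [Finset.mem_union]; tauto
    rw [this]
    exact Peel.both hR.symm h.symm hL.symm hadj'.symm hadj.symm hd'.symm hd.symm hd''.symm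
      (by rw [ee_comm]; exact he') (by rw [ee_comm]; exact he) (by rw [ee_comm]; exact he'')

lemma Peel.step {y : V} {A B : Finset V} {a b c d : V} (h : Peel H y A a c) (hB : Ch H B d b)
    (hd : Disjoint A B) (hadj : H.Adj c d) (he : ee H A B = 1) : Peel H y (A ∪ B) a b := by
  have hdB := hB.left_mem
  cases h with
  | mid h => exact Peel.rt h hB hadj hd he
  | @rt Q R _ q r _ h hR hadj0 hd0 he0 =>
    rw [Finset.disjoint_union_left] at hd
    rw [ee_union_left _ hd0] at he
    have k1 := ee_nonneg (H := H) Q B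
    have k2 := ee_pos hR.right_mem hdB hadj
    rw [Finset.union_assoc]
    refine Peel.rt h (Ch.join hR hB hd.2 hadj (by omega)) hadj0
      (Finset.disjoint_union_right.2 ⟨hd0, hd.1⟩) ?_
    rw [ee_union_right _ hd.2]; omega
  | @lf L Q _ l q _ hL h hadj0 hd0 he0 =>
    rw [Finset.disjoint_union_left] at hd
    rw [ee_union_left _ hd0] at he
    have k1 := ee_nonneg (H := H) L B
    have k2 := ee_pos h.1.symm.left_mem hdB hadj
    exact Peel.both hL h hB hadj0 hadj hd0 hd.2 hd.1 he0 (by omega) (by omega)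
  | @both L Q R _ l q q' r _ hL h hR hadj0 hadj1 hd0 hd1 hd2 he0 he1 he2 =>
    rw [Finset.disjoint_union_left, Finset.disjoint_union_left] at hd
    rw [ee_union_left _ (Finset.disjoint_union_left.2 ⟨hd2, hd1⟩), ee_union_left _ hd0] at he
    have k1 := ee_nonneg (H := H) L B
    have k3 := ee_nonneg (H := H) Q B
    have k2 := ee_pos hR.right_mem hdB hadj
    rw [Finset.union_assoc]
    refine Peel.both hL h (Ch.join hR hB hd.2 hadj (by omega)) hadj0 hadj1 hd0
      (Finset.disjoint_union_right.2 ⟨hd1, hd.1.2⟩)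
      (Finset.disjoint_union_right.2 ⟨hd2, hd.1.1⟩) he0 ?_ ?_
    · rw [ee_union_right _ hd.2]; omega
    · rw [ee_union_right _ hd.2]; omega

/-- `y` has room for one more edge. -/
def Room (H : SimpleGraph V) (S : Finset V) (a b y : V) : Prop :=
  ee H {y} S ≤ 2 ∧ (y = a → ee H {y} S ≤ 1) ∧ (y = b → ee H {y} S ≤ 1)

lemma Room.symm {S : Finset V} {a b y : V} (h : Room H S a b y) : Room H S b a y :=
  ⟨h.1, h.2.2, h.2.1⟩

lemma Room.left {A B : Finset V} {a b c d y : V} (h : Room H (A ∪ B) a b y) (hd : Disjoint A B)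
    (hdB : d ∈ B) (hadj : H.Adj c d) : Room H A a c y := by
  have m := ee_mono_right (H := H) (A := A) (B := A ∪ B) {y} Finset.subset_union_left
  refine ⟨m.trans h.1, fun hy => m.trans (h.2.1 hy), fun hy => ?_⟩
  subst hy
  have := deg_less (H := H) (S := A ∪ B) (L := A) Finset.subset_union_left
    (fun h => (Finset.disjoint_left.1 hd) h hdB) (Finset.mem_union_right _ hdB) hadj
  have := h.1
  omega

lemma Bless.deg {S : Finset V} {y z : V} (h : Bless H S) (hy : y ∈ S) (hz : z ∈ S) (hyz : y ≠ z) :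
    2 ≤ ee H {y} S := by
  have := h {y} (by simpa using hy) (by simp) (by
    intro h; rw [← h, Finset.mem_singleton] at hz; exact hyz hz.symm)
  exact this.trans (ee_mono_right _ Finset.sdiff_subset)

lemma Ch.peel {S : Finset V} {a b y : V} (h : Ch H S a b) (hy : y ∈ S) (hr : Room H S a b y) :
    Peel H y S a b := by
  induction h with
  | @blk Q a b h =>
    refine Peel.mid ⟨h, ?_⟩
    rcases h with ⟨rfl, rfl⟩ | ⟨h1, h2, h3, h4, h5, h6⟩
    · rw [Finset.mem_singleton] at hy
      subst hy
      exact ⟨Or.inl ⟨rfl, rfl⟩, Or.inl ⟨rfl, rfl⟩⟩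
    · have hdeg : 2 ≤ ee H {y} Q := by
        by_cases hya : y = a
        · subst hya; exact h1.deg h2 h3 h4
        · exact h1.deg hy h2 hya
      have ya : y ≠ a := fun h => by have := hr.2.1 h; omega
      have yb : y ≠ b := fun h => by have := hr.2.2 h; omega
      exact ⟨Or.inr ⟨h1, hy, h2, ya, hr.1, h5⟩, Or.inr ⟨h1, hy, h3, yb, hr.1, h6⟩⟩
  | @join A B a b c d hA hB hd hadj he ihA ihB =>
    rcases Finset.mem_union.1 hy with hy | hy
    · exact (ihA hy (hr.left hd hB.left_mem hadj)).step hB hd hadj he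
    · rw [Finset.union_comm] at hr ⊢
      have hr' := (hr.symm.left hd.symm hA.right_mem hadj.symm).symm
      exact ((ihB hy hr').symm.step hA.symm hd.symm hadj.symm
        (by rw [ee_comm]; exact he)).symm


/-- Two parallel chains between `x` and `y`. -/
def Theta (H : SimpleGraph V) (S : Finset V) (x y : V) : Prop :=
  ∃ (L R : Finset V) (l1 l2 r1 r2 : V), Ch H L l1 l2 ∧ Ch H R r1 r2 ∧ Disjoint L R ∧
    (x ∉ L ∧ x ∉ R) ∧ (y ∉ L ∧ y ∉ R) ∧ x ≠ y ∧ (H.Adj x l1 ∧ H.Adj x r1) ∧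
    (H.Adj y l2 ∧ H.Adj y r2) ∧ S = {x} ∪ {y} ∪ (L ∪ R) ∧ Phi H S = Phi H L + Phi H R + 32

def Strong (H : SimpleGraph V) (S : Finset V) (x y : V) : Prop :=
  ∃ lp lu : ℕ, Tr H S x y lp ∧ Tr H S x x lu ∧
    ((16 * (lp : ℤ) ≤ Phi H S - 44 ∧ 16 * (lu : ℤ) ≤ Phi H S - 28) ∨
     (Theta H S x y ∧ 16 * (lp : ℤ) ≤ Phi H S - 40 ∧ 16 * (lu : ℤ) ≤ Phi H S - 40) ∨
     (16 * (lp : ℤ) ≤ Phi H S - 56 ∧ 16 * (lu : ℤ) ≤ Phi H S - 24))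

def Data (H : SimpleGraph V) (S : Finset V) (a b : V) : Prop :=
  ∃ lp lu : ℕ, Tr H S a b lp ∧ Tr H S a a lu ∧ 16 * (lp : ℤ) ≤ Phi H S - 36 ∧
    16 * (lp : ℤ) + 16 * (lu : ℤ) ≤ 2 * Phi H S - 72

/-- Induction hypothesis. -/
def Hyp (H : SimpleGraph V) (n : ℕ) : Prop :=
  ∀ (Q : Finset V) (a b : V), Q.card ≤ n → Bless H Q → a ∈ Q → b ∈ Q → a ≠ b →
    ee H {a} Q ≤ 2 → ee H {b} Q ≤ 2 → Strong H Q a b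

lemma Strong.data {S : Finset V} {x y : V} (h : Strong H S x y) : Data H S x y := by
  obtain ⟨lp, lu, h1, h2, h3⟩ := h
  refine ⟨lp, lu, h1, h2, ?_⟩
  omega

lemma Blk.data {n : ℕ} (hyp : Hyp H n) {Q : Finset V} {a b : V} (hQ : Q.card ≤ n)
    (h : Blk H Q a b) : Data H Q a b := by
  rcases h with ⟨rfl, rfl⟩ | ⟨h1, h2, h3, h4, h5, h6⟩
  · exact ⟨0, 0, Tr.single a, Tr.single a, by rw [Phi_single]; norm_num,
      by rw [Phi_single]; norm_num⟩
  · exact (hyp Q a b hQ h1 h2 h3 h4 h5 h6).data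

lemma Ch.data {n : ℕ} (hyp : Hyp H n) {S : Finset V} {a b : V} (h : Ch H S a b)
    (hS : S.card ≤ n) : Data H S a b := by
  induction h with
  | blk h => exact h.data hyp hS
  | @join A B a b c d hA hB hd hadj he ihA ihB =>
    obtain ⟨p1, u1, t1, s1, i1, j1⟩ :=
      ihA ((Finset.card_le_card Finset.subset_union_left).trans hS)
    obtain ⟨p2, u2, t2, s2, i2, j2⟩ :=
      ihB ((Finset.card_le_card Finset.subset_union_right).trans hS)
    have hPhi := Phi_union (H := H) hd
    rw [he] at hPhi
    refine ⟨_, _, t1.series t2 hadj hd, s1.attach s2 hA.right_mem hB.left_mem hadj hd, ?_, ?_⟩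
    · push_cast; omega
    · push_cast; omega

lemma Peel.data {n : ℕ} (hyp : Hyp H n) {S : Finset V} {a b y : V} (h : Peel H y S a b)
    (hS : S.card ≤ n) : ∃ l l1 l2 : ℕ, Tr H S a b l ∧ Tr H S y a l1 ∧ Tr H S y b l2 ∧
      16 * (l : ℤ) + 16 * l1 ≤ 2 * Phi H S - 72 ∧ 16 * (l : ℤ) + 16 * l2 ≤ 2 * Phi H S - 72 ∧
      16 * (l1 : ℤ) + 16 * l2 ≤ 2 * Phi H S - 72 := by
  cases h with
  | mid h =>
    obtain ⟨p, _, t, _, i, _⟩ := h.1.data hyp hS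
    obtain ⟨p1, _, t1, _, i1, _⟩ := h.2.1.data hyp hS
    obtain ⟨p2, _, t2, _, i2, _⟩ := h.2.2.data hyp hS
    exact ⟨p, p1, p2, t, t1, t2, by omega, by omega, by omega⟩
  | @rt Q R _ q r _ h hR hadj hd he =>
    have cQ := (Finset.card_le_card (Finset.subset_union_left (s₁ := Q) (s₂ := R))).trans hS
    have cR := (Finset.card_le_card (Finset.subset_union_right (s₁ := Q) (s₂ := R))).trans hS
    obtain ⟨p, _, t, _, i, _⟩ := h.1.data hyp cQ
    obtain ⟨p1, _, t1, _, i1, _⟩ := h.2.1.data hyp cQ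
    obtain ⟨p2, _, t2, _, i2, _⟩ := h.2.2.data hyp cQ
    obtain ⟨pR, uR, tR, sR, iR, jR⟩ := hR.data hyp cR
    have hPhi := Phi_union (H := H) hd
    rw [he] at hPhi
    refine ⟨_, _, _, t.series tR hadj hd, t1.attach sR h.1.symm.left_mem hR.left_mem hadj hd,
      t2.series tR hadj hd, ?_, ?_, ?_⟩ <;> push_cast <;> omega
  | @lf L Q _ l q _ hL h hadj hd he =>
    have cL := (Finset.card_le_card (Finset.subset_union_left (s₁ := L) (s₂ := Q))).trans hS
    have cQ := (Finset.card_le_card (Finset.subset_union_right (s₁ := L) (s₂ := Q))).trans hS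
    obtain ⟨p, _, t, _, i, _⟩ := h.1.data hyp cQ
    obtain ⟨p1, _, t1, _, i1, _⟩ := h.2.1.data hyp cQ
    obtain ⟨p2, _, t2, _, i2, _⟩ := h.2.2.data hyp cQ
    obtain ⟨pL, uL, tL, sL, iL, jL⟩ := hL.data hyp cL
    have hPhi := Phi_union (H := H) hd
    rw [he] at hPhi
    refine ⟨_, _, _, tL.series t hadj hd, (tL.series t1.symm hadj hd).symm,
      (t2.attach sL h.1.left_mem hL.right_mem hadj.symm hd.symm).cast
        (Finset.union_comm _ _) rfl, ?_, ?_, ?_⟩ <;> push_cast <;> omega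
  | @both L Q R _ l q q' r _ hL h hR hadj hadj' hd hd' hd'' he he' he'' =>
    have cR := (Finset.card_le_card (Finset.subset_union_right (s₁ := L ∪ Q) (s₂ := R))).trans hS
    have cLQ := (Finset.card_le_card (Finset.subset_union_left (s₁ := L ∪ Q) (s₂ := R))).trans hS
    have cL := (Finset.card_le_card (Finset.subset_union_left (s₁ := L) (s₂ := Q))).trans cLQ
    have cQ := (Finset.card_le_card (Finset.subset_union_right (s₁ := L) (s₂ := Q))).trans cLQ
    obtain ⟨p, _, t, _, i, _⟩ := h.1.data hyp cQ
    obtain ⟨p1, _, t1, _, i1, _⟩ := h.2.1.data hyp cQ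
    obtain ⟨p2, _, t2, _, i2, _⟩ := h.2.2.data hyp cQ
    obtain ⟨pL, uL, tL, sL, iL, jL⟩ := hL.data hyp cL
    obtain ⟨pR, uR, tR, sR, iR, jR⟩ := hR.data hyp cR
    have hdLQ : Disjoint (L ∪ Q) R := Finset.disjoint_union_left.2 ⟨hd'', hd'⟩
    have hdQR : Disjoint L (Q ∪ R) := Finset.disjoint_union_right.2 ⟨hd, hd''⟩
    have hPhi := Phi_union (H := H) hdLQ
    rw [Phi_union hd, ee_union_left _ hd, he, he', he''] at hPhi
    have mq' : q' ∈ Q := h.1.symm.left_mem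
    have mq : q ∈ Q := h.1.left_mem
    refine ⟨_, _, _, (tL.series t hadj hd).series tR hadj' hdLQ,
      (tL.series t1.symm hadj hd).symm.attach sR (Finset.mem_union_right _ mq') hR.left_mem
        hadj' hdLQ,
      ((t2.series tR hadj' hd').attach sL (Finset.mem_union_left _ mq) hL.right_mem hadj.symm
        hdQR.symm).cast (by rw [Finset.union_comm, Finset.union_assoc]) rfl, ?_, ?_, ?_⟩ <;>
      push_cast <;> omega

lemma theta_path (h3 : Sub3 H) {n : ℕ} (hyp : Hyp H n) {L R : Finset V}
    {l1 l2 r1 r2 x x1 x2 y : V} (hL : Ch H L l1 l2) (hR : Ch H R r1 r2) (hd : Disjoint L R)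
    (cL : L.card ≤ n) (cR : R.card ≤ n)
    (hx : x ∉ L ∧ x ∉ R) (hx1 : x1 ∉ L ∧ x1 ∉ R) (hy : y ∉ L ∧ y ∉ R)
    (hxx1 : x ≠ x1) (hxy : x ≠ y) (hx1y : x1 ≠ y) (hx2 : x2 ∈ L)
    (a1 : H.Adj x x1) (a2 : H.Adj x x2) (a3 : H.Adj x1 l1 ∧ H.Adj x1 r1)
    (a4 : H.Adj y l2 ∧ H.Adj y r2) :
    ∃ l : ℕ, Tr H ({x} ∪ ({x1} ∪ {y} ∪ (L ∪ R))) x y l ∧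
      16 * (l : ℤ) ≤ Phi H L + Phi H R + 4 := by
  have hroom : Room H L l1 l2 x2 := by
    refine ⟨deg_out1 h3 hx.1 a2.symm, fun h => ?_, fun h => ?_⟩
    · exact deg_out2 h3 hx.1 a2.symm hx1.1 (h ▸ a3.1.symm) hxx1
    · exact deg_out2 h3 hx.1 a2.symm hy.1 (h ▸ a4.1.symm) hxy
  obtain ⟨l, m1, m2, t, t1, t2, i1, i2, i3⟩ := (hL.peel hx2 hroom).data hyp cL
  obtain ⟨pR, uR, tR, sR, iR, jR⟩ := hR.data hyp cR
  have hdl := Finset.disjoint_left.1 hd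
  by_cases hcase : 16 * (l : ℤ) + 16 * uR + 80 ≤ Phi H L + Phi H R + 4
  · have o := ((((t.series (Tr.single y) a4.1.symm (by simpa using hy.1)).cons (x := x1)
      (by simp [hx1.1, hx1y]) a3.1).cons (x := x)
      (by simp [hx.1, hxx1, hxy]) a1).attach sR (u := x1) (c := r1) (by simp) hR.left_mem a3.2
      (by
        rw [Finset.disjoint_left]; intro v hv hvR
        simp only [Finset.mem_union, Finset.mem_singleton] at hv
        rcases hv with rfl | rfl | hv | rfl
        · exact hx.2 hvR
        · exact hx1.2 hvR
        · exact hdl hv hvR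
        · exact hy.2 hvR))
    refine ⟨_, o.cast (by ext v; simp only [Finset.mem_union]; tauto) rfl, ?_⟩
    push_cast; omega
  · have o := (((t1.series (Tr.single x1) a3.1.symm (by simpa using hx1.1)).series tR a3.2
      (by
        rw [Finset.disjoint_left]; intro v hv hvR
        simp only [Finset.mem_union, Finset.mem_singleton] at hv
        rcases hv with hv | rfl
        · exact hdl hv hvR
        · exact hx1.2 hvR)).series (Tr.single y) a4.2.symm
      (by simp [hy.1, hy.2, hx1y.symm])).cons (x := x)
      (by simp [hx.1, hx.2, hxx1, hxy]) a2
    refine ⟨_, o.cast (by ext v; simp only [Finset.mem_union]; tauto) rfl, ?_⟩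
    push_cast; omega

lemma theta_path' {n : ℕ} (hyp : Hyp H n) {L R : Finset V}
    {l1 l2 r1 r2 x x1 x2 y : V} (hL : Ch H L l1 l2) (hR : Ch H R r1 r2) (hd : Disjoint L R)
    (cL : L.card ≤ n) (cR : R.card ≤ n) (hroom : Room H L l1 l2 y)
    (hx : x ∉ L ∧ x ∉ R) (hx1 : x1 ∉ L ∧ x1 ∉ R) (hx2 : x2 ∉ L ∧ x2 ∉ R)
    (hxx1 : x ≠ x1) (hxx2 : x ≠ x2) (hx12 : x1 ≠ x2) (hy : y ∈ L)
    (a1 : H.Adj x x1) (a2 : H.Adj x x2) (a3 : H.Adj x1 l1 ∧ H.Adj x1 r1)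
    (a4 : H.Adj x2 l2 ∧ H.Adj x2 r2) :
    ∃ l : ℕ, Tr H ({x} ∪ ({x1} ∪ {x2} ∪ (L ∪ R))) x y l ∧
      16 * (l : ℤ) ≤ Phi H L + Phi H R - 8 := by
  obtain ⟨l, m1, m2, t, t1, t2, i1, i2, i3⟩ := (hL.peel hy hroom).data hyp cL
  obtain ⟨pR, uR, tR, sR, iR, jR⟩ := hR.data hyp cR
  have hdl := Finset.disjoint_left.1 hd
  -- generic route
  have route : ∀ {z1 z2 s1 s2 k : V} {m : ℕ}, Tr H R s1 s2 pR → Tr H L y k m →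
      H.Adj x z1 → H.Adj z1 s1 → H.Adj s2 z2 → H.Adj z2 k → z1 ∉ L → z1 ∉ R → z2 ∉ L → z2 ∉ R →
      z1 ≠ z2 → x ≠ z1 → x ≠ z2 →
      Tr H ({x} ∪ ({z1} ∪ {z2} ∪ (L ∪ R))) x y (pR + m + 4) := by
    intro z1 z2 s1 s2 k m u1 u2 b1 b2 b3 b4 n1 n2 n3 n4 n5 n6 n7
    have o := (((u1.series (Tr.single z2) b3 (by simpa using n4)).series u2.symm b4
      (by
        rw [Finset.disjoint_left]; intro v hv hvL
        simp only [Finset.mem_union, Finset.mem_singleton] at hv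
        rcases hv with hv | rfl
        · exact hdl hvL hv
        · exact n3 hvL)).cons (x := z1) (by simp [n1, n2, n5]) b2).cons (x := x)
        (by simp [hx.1, hx.2, n6, n7]) b1
    exact o.cast (by ext v; simp only [Finset.mem_union]; tauto) (by omega)
  by_cases hcase : 16 * (m2 : ℤ) ≤ Phi H L - 36
  · refine ⟨_, route tR t2 a1 a3.2 a4.2.symm a4.1 hx1.1 hx1.2 hx2.1 hx2.2 hx12 hxx1 hxx2, ?_⟩
    push_cast; omega
  · refine ⟨_, (route tR.symm t1 a2 a4.2 a3.2.symm a3.1 hx2.1 hx2.2 hx1.1 hx1.2 hx12.symm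
      hxx2 hxx1).cast (by ext v; simp only [Finset.mem_union]; tauto) rfl, ?_⟩
    push_cast; omega


lemma main_step (h3 : Sub3 H) {n : ℕ} (hyp : Hyp H n) {S : Finset V} {x x1 x2 y : V}
    (hx : x ∉ S) (cS : S.card ≤ n) (a1 : H.Adj x x1) (a2 : H.Adj x x2) (h12 : x1 ≠ x2)
    (hPhi : Phi H ({x} ∪ S) = Phi H S + 16) (hch : Ch H S x1 x2) (hy : y ∈ S)
    (hroom : Room H S x1 x2 y) : Strong H ({x} ∪ S) x y := by
  have hxy : x ≠ y := fun h => hx (h ▸ hy)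
  have hxx1 : x ≠ x1 := a1.ne
  have hxx2 : x ≠ x2 := a2.ne
  cases hch.peel hy hroom with
  | mid h =>
    obtain ⟨b1, b2, b3⟩ := h
    have m1 := b1.left_mem
    have m2 := b1.symm.left_mem
    rcases b1 with ⟨_, h⟩ | ⟨hB, _, _, _, d1, d2⟩
    · exact absurd h h12
    rcases b2.symm with ⟨h, _⟩ | ⟨_, _, _, n1, _, dy⟩
    · rw [h, Finset.mem_singleton] at m2; exact absurd m2.symm h12
    rcases b3.symm with ⟨h, _⟩ | ⟨_, _, _, n2, _, _⟩
    · rw [h, Finset.mem_singleton] at m1; exact absurd m1 h12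
    -- the traversal
    have hp : ∃ lp : ℕ, Tr H ({x} ∪ S) x y lp ∧ 16 * (lp : ℤ) ≤ Phi H ({x} ∪ S) - 44 := by
      obtain ⟨lp, lu, t, s, hc⟩ := hyp S x1 y cS hB m1 hy n1 d1 dy
      have easy : 16 * (lp : ℤ) ≤ Phi H S - 44 → ∃ lp : ℕ, Tr H ({x} ∪ S) x y lp ∧
          16 * (lp : ℤ) ≤ Phi H ({x} ∪ S) - 44 := fun hle =>
        ⟨_, t.cons hx a1, by push_cast; omega⟩
      rcases hc with hc | ⟨⟨L, R, l1, l2, r1, r2, hL, hR, hd, k1, k2, k3, k4, k5, hS, hPS⟩, -⟩ | hc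
      · exact easy hc.1
      · have cL : L.card ≤ n := (Finset.card_le_card (by
          rw [hS]; intro v hv; simp [hv])).trans cS
        have cR : R.card ≤ n := (Finset.card_le_card (by
          rw [hS]; intro v hv; simp [hv])).trans cS
        have hxL : x ∉ L ∧ x ∉ R := by
          rw [hS] at hx; simp at hx; tauto
        have hm : x2 ∈ L ∨ x2 ∈ R := by
          rw [hS] at m2; simp at m2
          rcases m2 with h | h | h | h
          · exact absurd h.symm h12
          · exact absurd h n2
          · exact Or.inl h
          · exact Or.inr h
        rcases hm with hm | hm
        · obtain ⟨l, t, hl⟩ := theta_path h3 hyp hL hR hd cL cR hxL k1 k2 hxx1 hxy k3 hm a1 a2 k4 k5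
          rw [← hS] at t
          exact ⟨l, t, by omega⟩
        · obtain ⟨l, t, hl⟩ := theta_path h3 hyp hR hL hd.symm cR cL hxL.symm k1.symm k2.symm
            hxx1 hxy k3 hm a1 a2 k4.symm k5.symm
          rw [Finset.union_comm R L, ← hS] at t
          exact ⟨l, t, by omega⟩
      · exact easy (by omega)
    obtain ⟨lp, lu, t, s, hc⟩ := hyp S x1 x2 cS hB m1 m2 h12 d1 d2
    have tc := t.close hx a1 a2
    have easy : 16 * (lp : ℤ) ≤ Phi H S - 44 → Strong H ({x} ∪ S) x y := by
      intro hle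
      obtain ⟨l, t', hl⟩ := hp
      exact ⟨l, _, t', tc, Or.inl ⟨hl, by push_cast; omega⟩⟩
    rcases hc with hc | ⟨⟨L, R, l1, l2, r1, r2, hL, hR, hd, k1, k2, k3, k4, k5, hS, hPS⟩, hl, -⟩ | hc
    · exact easy hc.1
    · have sL : L ⊆ S := by rw [hS]; intro v hv; simp [hv]
      have sR : R ⊆ S := by rw [hS]; intro v hv; simp [hv]
      have cL := (Finset.card_le_card sL).trans cS
      have cR := (Finset.card_le_card sR).trans cS
      have hxL : x ∉ L ∧ x ∉ R := ⟨fun h => hx (sL h), fun h => hx (sR h)⟩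
      have hm : y ∈ L ∨ y ∈ R := by
        rw [hS] at hy; simp at hy
        rcases hy with h | h | h | h
        · exact absurd h.symm n1
        · exact absurd h.symm n2
        · exact Or.inl h
        · exact Or.inr h
      have room : ∀ {L : Finset V} {l1 l2 : V}, L ⊆ S → x1 ∉ L → x2 ∉ L → H.Adj x1 l1 →
          H.Adj x2 l2 → Room H L l1 l2 y := by
        intro L l1 l2 sL q1 q2 q3 q4
        refine ⟨(ee_mono_right _ sL).trans dy, fun h => ?_, fun h => ?_⟩
        · have := deg_less (H := H) (z := y) sL q1 m1 (h ▸ q3.symm)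
          omega
        · have := deg_less (H := H) (z := y) sL q2 m2 (h ▸ q4.symm)
          omega
      have : ∃ l : ℕ, Tr H ({x} ∪ S) x y l ∧ 16 * (l : ℤ) ≤ Phi H L + Phi H R - 8 := by
        rcases hm with hm | hm
        · obtain ⟨l, t, hl⟩ := theta_path' hyp hL hR hd cL cR (room sL k1.1 k2.1 k4.1 k5.1)
            hxL k1 k2 hxx1 hxx2 h12 hm a1 a2 k4 k5
          rw [← hS] at t
          exact ⟨l, t, hl⟩
        · obtain ⟨l, t, hl⟩ := theta_path' hyp hR hL hd.symm cR cL (room sR k1.2 k2.2 k4.2 k5.2)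
            hxL.symm k1.symm k2.symm hxx1 hxx2 h12 hm a1 a2 k4.symm k5.symm
          rw [Finset.union_comm R L, ← hS] at t
          exact ⟨l, t, by omega⟩
      obtain ⟨l, t', hl'⟩ := this
      exact ⟨l, _, t', tc, Or.inr (Or.inr ⟨by omega, by push_cast; omega⟩)⟩
    · exact easy (by omega)
  | @rt Q R _ q r _ h hR hadj hd he =>
    have cQ := (Finset.card_le_card (Finset.subset_union_left (s₁ := Q) (s₂ := R))).trans cS
    have cR := (Finset.card_le_card (Finset.subset_union_right (s₁ := Q) (s₂ := R))).trans cS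
    obtain ⟨p, _, t, _, i, _⟩ := h.1.data hyp cQ
    obtain ⟨p2, _, t2, _, i2, _⟩ := h.2.2.data hyp cQ
    obtain ⟨pR, uR, tR, sR, iR, jR⟩ := hR.data hyp cR
    have hPhi' := Phi_union (H := H) hd
    rw [he] at hPhi'
    exact ⟨_, _, (t2.series tR hadj hd).symm.cons hx a2, (t.series tR hadj hd).close hx a1 a2,
      Or.inl ⟨by push_cast; omega, by push_cast; omega⟩⟩
  | @lf L Q _ l q _ hL h hadj hd he =>
    have cL := (Finset.card_le_card (Finset.subset_union_left (s₁ := L) (s₂ := Q))).trans cS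
    have cQ := (Finset.card_le_card (Finset.subset_union_right (s₁ := L) (s₂ := Q))).trans cS
    obtain ⟨p, _, t, _, i, _⟩ := h.1.data hyp cQ
    obtain ⟨p1, _, t1, _, i1, _⟩ := h.2.1.data hyp cQ
    obtain ⟨pL, uL, tL, sL, iL, jL⟩ := hL.data hyp cL
    have hPhi' := Phi_union (H := H) hd
    rw [he] at hPhi'
    exact ⟨_, _, (tL.series t1.symm hadj hd).cons hx a1, (tL.series t hadj hd).close hx a1 a2,
      Or.inl ⟨by push_cast; omega, by push_cast; omega⟩⟩
  | @both L Q R _ l q q' r _ hL h hR hadj hadj' hd hd' hd'' he he' he'' =>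
    have cR := (Finset.card_le_card (Finset.subset_union_right (s₁ := L ∪ Q) (s₂ := R))).trans cS
    have cLQ := (Finset.card_le_card (Finset.subset_union_left (s₁ := L ∪ Q) (s₂ := R))).trans cS
    have cL := (Finset.card_le_card (Finset.subset_union_left (s₁ := L) (s₂ := Q))).trans cLQ
    have cQ := (Finset.card_le_card (Finset.subset_union_right (s₁ := L) (s₂ := Q))).trans cLQ
    obtain ⟨pL, uL, tL, sL, iL, jL⟩ := hL.data hyp cL
    obtain ⟨pR, uR, tR, sR, iR, jR⟩ := hR.data hyp cR
    have hdLQ : Disjoint (L ∪ Q) R := Finset.disjoint_union_left.2 ⟨hd'', hd'⟩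
    have hdQR : Disjoint L (Q ∪ R) := Finset.disjoint_union_right.2 ⟨hd, hd''⟩
    have hPhi' := Phi_union (H := H) hdLQ
    rw [Phi_union hd, ee_union_left _ hd, he, he', he''] at hPhi'
    have mq' : q' ∈ Q := h.1.symm.left_mem
    have mq : q ∈ Q := h.1.left_mem
    obtain ⟨p, _, t, _, i, _⟩ := h.1.data hyp cQ
    have hp : ∀ (k : ℤ) (p1 p2 : ℕ), Tr H Q y q p1 → Tr H Q y q' p2 →
        16 * (p1 : ℤ) ≤ Phi H Q + k → 16 * (p2 : ℤ) ≤ Phi H Q + k →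
        ∃ lp : ℕ, Tr H ({x} ∪ (L ∪ Q ∪ R)) x y lp ∧
          16 * (lp : ℤ) ≤ Phi H ({x} ∪ (L ∪ Q ∪ R)) + k - 4 := by
      intro k p1 p2 t1 t2 i1 i2
      have o1 := ((tL.series t1.symm hadj hd).attach sR (Finset.mem_union_right _ mq') hR.left_mem
        hadj' hdLQ).cons hx a1
      have o2 := ((((t2.series tR hadj' hd').attach sL (Finset.mem_union_left _ mq) hL.right_mem
        hadj.symm hdQR.symm).cast (S' := L ∪ Q ∪ R)
          (by rw [Finset.union_comm, Finset.union_assoc]) rfl).symm).cons hx a2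
      by_cases hc : 16 * (pL : ℤ) + 16 * uR ≤ Phi H L + Phi H R - 72
      · exact ⟨_, o1, by push_cast; omega⟩
      · exact ⟨_, o2, by push_cast; omega⟩
    have tc := ((tL.series t hadj hd).series tR hadj' hdLQ).close hx a1 a2
    by_cases hQ : Q = {y}
    · subst hQ
      obtain rfl : q = y := by simpa using mq
      obtain rfl : q' = q := by simpa using mq'
      have hs := Phi_single (H := H) q'
      obtain ⟨lp, t', hl⟩ := hp (-36) 0 0 (Tr.single _) (Tr.single _) (by omega) (by omega)
      refine ⟨_, _, t', tc, Or.inr (Or.inl ⟨⟨L, R, x1, l, x2, r, hL, hR.symm, hd'', ?_, ?_, hxy,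
        ⟨a1, a2⟩, ⟨hadj.symm, hadj'⟩, ?_, by omega⟩, by omega, by push_cast; omega⟩)⟩
      · simp at hx; tauto
      · simp at hd hd'; tauto
      · ext v; simp only [Finset.mem_union]; tauto
    · have st : ∀ z, Blk H Q y z → ∃ p1 : ℕ, Tr H Q y z p1 ∧ 16 * (p1 : ℤ) ≤ Phi H Q + (-40) := by
        intro z hz
        rcases hz with ⟨h, _⟩ | ⟨e1, e2, e3', e4, e5, e6⟩
        · exact absurd h hQ
        · obtain ⟨lp, lu, t, s, hc⟩ := hyp Q y z cQ e1 e2 e3' e4 e5 e6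
          exact ⟨lp, t, by omega⟩
      obtain ⟨p1, t1, i1⟩ := st _ h.2.1
      obtain ⟨p2, t2, i2⟩ := st _ h.2.2
      obtain ⟨lp, t', hl⟩ := hp (-40) p1 p2 t1 t2 i1 i2
      exact ⟨_, _, t', tc, Or.inl ⟨by omega, by push_cast; omega⟩⟩

lemma hyp_all (h3 : Sub3 H) : ∀ n, Hyp H n := by
  intro n
  induction n with
  | zero =>
    intro Q a b hn _ ha
    have : Q = ∅ := by simpa using hn
    rw [this] at ha
    simp at ha
  | succ n ih =>
    intro Q x y hn hB hx hy hxy dx dy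
    have d2 : ee H {x} Q = 2 := le_antisymm dx (hB.deg hx hy hxy)
    obtain ⟨x0, hx0, x1, m1, a1⟩ := exists_of_ee_pos (H := H) (A := {x}) (B := Q) (by omega)
    rw [Finset.mem_singleton] at hx0
    rw [hx0] at a1
    have k1 := ee_split_right (H := H) (A := {x1}) (B := Q) {x} (by simpa using m1)
    rw [ee_single a1] at k1
    obtain ⟨x', hx', x2, m2, a2⟩ := exists_of_ee_pos (H := H) (A := {x}) (B := Q \ {x1})
      (by omega)
    rw [Finset.mem_singleton] at hx'
    rw [hx'] at a2
    rw [Finset.mem_sdiff, Finset.mem_singleton] at m2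
    obtain ⟨m2, h21⟩ := m2
    have h12 : x1 ≠ x2 := fun h => h21 h.symm
    -- neighbours of x in a subset
    have nb : ∀ T, T ⊆ Q → ee H {x} T ≤ (if x1 ∈ T then 1 else 0) + (if x2 ∈ T then 1 else 0) := by
      intro T hT
      by_cases t1 : x1 ∈ T
      · by_cases t2 : x2 ∈ T
        · rw [if_pos t1, if_pos t2]
          have := ee_mono_right (H := H) {x} hT; omega
        · rw [if_pos t1, if_neg t2]
          have := deg_less hT t2 m2 a2; omega
      · by_cases t2 : x2 ∈ T
        · rw [if_neg t1, if_pos t2]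
          have := deg_less hT t1 m1 a1; omega
        · rw [if_neg t1, if_neg t2]
          have := deg_less (H := H) (z := x) (u := x2) (L := T ∪ {x1}) (S := Q)
            (Finset.union_subset hT (by simpa using m1)) (by simp [t2, h21]) m2 a2
          rw [ee_union_right _ (by simpa using t1), ee_single a1] at this
          omega
    have hQ : Q = {x} ∪ (Q \ {x}) := by
      rw [Finset.union_sdiff_of_subset]; simpa using hx
    set S := Q \ {x} with hS
    have hxS : x ∉ S := by simp [hS]
    have sub : S ⊆ Q := Finset.sdiff_subset
    have m1' : x1 ∈ S := by simp [hS, m1, a1.ne.symm]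
    have m2' : x2 ∈ S := by simp [hS, m2, a2.ne.symm]
    have my : y ∈ S := by simp [hS, hy, hxy.symm]
    have base : ∀ T, T ⊆ S → T.Nonempty → ¬ (x1 ∈ T ∧ x2 ∈ T) →
        2 ≤ ee H T (S \ T) + (if x1 ∈ T ↔ x2 ∈ T then 0 else 1) := by
      intro T hT hne hn
      have := hB T (hT.trans sub) hne (by rintro rfl; exact hxS (hT hx))
      have e1 : Q \ T = {x} ∪ (S \ T) := by
        ext v
        have := @hT v
        have hxT : x ∉ T := fun h => hxS (hT h)
        simp only [hS, Finset.mem_sdiff, Finset.mem_union, Finset.mem_singleton]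
        constructor
        · tauto
        · rintro (rfl | h)
          · exact ⟨hx, hxT⟩
          · tauto
      rw [e1, ee_union_right _ (by simp [hS]), ee_comm T {x}] at this
      have hnb := nb T (hT.trans sub)
      by_cases t1 : x1 ∈ T <;> by_cases t2 : x2 ∈ T <;> simp [t1, t2] at hnb hn ⊢ <;> omega
    have cc : CutChain H S x1 x2 := by
      refine ⟨m1', m2', deg_out1 h3 hxS a1.symm, deg_out1 h3 hxS a2.symm,
        fun h => absurd h h12, fun T hT hne hTS => ?_⟩
      by_cases hb : x1 ∈ T ∧ x2 ∈ T
      · have hne' : (S \ T).Nonempty := by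
          rw [Finset.sdiff_nonempty]; exact fun h => hTS (hT.antisymm h)
        have := base (S \ T) Finset.sdiff_subset hne' (by simp [hb.1])
        rw [compl_cut hT] at this
        simpa [hb.1, hb.2] using this
      · exact base T hT hne hb
    have cS : S.card ≤ n := by
      have : S.card < Q.card := Finset.card_lt_card ⟨sub, fun h => hxS (h hx)⟩
      omega
    have room : Room H S x1 x2 y := by
      refine ⟨(ee_mono_right _ sub).trans dy, fun h => ?_, fun h => ?_⟩
      · have := deg_less (H := H) (z := y) sub hxS hx (h ▸ a1.symm)
        omega
      · have := deg_less (H := H) (z := y) sub hxS hx (h ▸ a2.symm)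
        omega
    have hPhi : Phi H ({x} ∪ S) = Phi H S + 16 := by
      have e : ee H {x} S = 2 := by
        have h := ee_union_right (H := H) (A := {x}) (B := S) {x} (by simpa using hxS)
        rw [← hQ, ee_self, d2] at h
        omega
      rw [Phi_union (by simpa using hxS), e, Phi_single]; ring
    have := main_step h3 ih hxS cS a1 a2 h12 hPhi (CutChain.ch h3 n cS cc) my room
    rw [← hQ] at this
    exact this


lemma ee_del {G : SimpleGraph V} {x y : V} (hxy : G.Adj x y) (A B : Finset V) :
    ee G A B = ee (G.deleteEdges {s(x, y)}) A B + (if x ∈ A ∧ y ∈ B then 1 else 0)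
      + (if y ∈ A ∧ x ∈ B then 1 else 0) := by
  classical
  have key : ∀ a b, (if G.Adj a b then (1 : ℤ) else 0) =
      (if (G.deleteEdges {s(x, y)}).Adj a b then (1 : ℤ) else 0)
        + (if a = x then (if b = y then 1 else 0) else 0)
        + (if a = y then (if b = x then 1 else 0) else 0) := by
    intro a b
    have hne := hxy.ne
    have hyx := hxy.symm
    simp only [deleteEdges_adj, Set.mem_singleton_iff, Sym2.eq_iff]
    by_cases h1 : a = x ∧ b = y
    · obtain ⟨rfl, rfl⟩ := h1
      simp [hxy, hne]
    · by_cases h2 : a = y ∧ b = x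
      · obtain ⟨rfl, rfl⟩ := h2
        simp [hyx, hne.symm]
      · have e1 : (if a = x then (if b = y then (1 : ℤ) else 0) else 0) = 0 := by
          split_ifs <;> tauto
        have e2 : (if a = y then (if b = x then (1 : ℤ) else 0) else 0) = 0 := by
          split_ifs <;> tauto
        rw [e1, e2]
        simp [h1, h2]
  have hs : ∀ p q : V, (∑ a ∈ A, ∑ b ∈ B, (if a = p then (if b = q then (1 : ℤ) else 0) else 0)) =
      if p ∈ A ∧ q ∈ B then 1 else 0 := by
    intro p q
    have : ∀ a ∈ A, (∑ b ∈ B, (if a = p then (if b = q then (1 : ℤ) else 0) else 0)) =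
        if a = p then (if q ∈ B then 1 else 0) else 0 := by
      intro a _
      by_cases h : a = p
      · simp [h]
      · simp [h]
    rw [Finset.sum_congr rfl this, Finset.sum_ite_eq']
    by_cases h : p ∈ A <;> simp [h]
  rw [← hs x y, ← hs y x]
  simp only [ee, dsum]
  rw [← Finset.sum_add_distrib, ← Finset.sum_add_distrib]
  refine Finset.sum_congr rfl fun a _ => ?_
  rw [← Finset.sum_add_distrib, ← Finset.sum_add_distrib]
  refine Finset.sum_congr rfl fun b _ => ?_
  convert key a b

lemma top_bless {G : SimpleGraph V} (h3 : Sub3 G) {S : Finset V} (hB : Bless G S) {x z : V}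
    (hx : x ∈ S) (hz : z ∈ S) (hxz : x ≠ z) :
    ∃ (a : V) (l : ℕ), Tr G S a a l ∧ 16 * (l : ℤ) ≤ 36 * S.card - 5 * ee G S S - 10 := by
  have h := hB.deg hx hz hxz
  obtain ⟨x0, hx0, y, hy, hxy⟩ := exists_of_ee_pos (H := G) (A := {x}) (B := S) (by omega)
  rw [Finset.mem_singleton] at hx0
  rw [hx0] at hxy
  have hdel := ee_del hxy
  set H := G.deleteEdges {s(x, y)} with hH
  have hne := hxy.ne
  have h3' : Sub3 H := by
    intro v T
    have := h3 v T
    rw [hdel] at this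
    split_ifs at this <;> omega
  have cc : CutChain H S x y := by
    refine ⟨hx, hy, ?_, ?_, fun h => absurd h hne, fun T hT h1 h2 => ?_⟩
    · have := h3 x S
      rw [hdel] at this
      simp [hy, hne.symm] at this
      omega
    · have := h3 y S
      rw [hdel] at this
      simp [hx, hne] at this
      omega
    · have := hB T hT h1 h2
      rw [hdel] at this
      by_cases t1 : x ∈ T <;> by_cases t2 : y ∈ T <;> simp [t1, t2, hx, hy] at this ⊢ <;> omega
  obtain ⟨lp, lu, ⟨w, w1, w2, w3⟩, _, hle, _⟩ :=
    (CutChain.ch h3' S.card le_rfl cc).data (hyp_all h3' S.card) le_rfl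
  have hSS := hdel S S
  rw [if_pos ⟨hx, hy⟩, if_pos ⟨hy, hx⟩] at hSS
  have hHG : H ≤ G := deleteEdges_le _
  refine ⟨y, lp + 1, ⟨Walk.cons hxy.symm (w.mapLe hHG), fun v => ?_, fun e => ?_, ?_⟩, ?_⟩
  · simp only [Walk.support_cons, List.mem_cons, Walk.support_mapLe_eq_support, w1]
    constructor
    · rintro (rfl | h)
      · exact hy
      · exact h
    · exact Or.inr
  · rw [Walk.edges_cons, Walk.edges_mapLe_eq_edges, List.count_cons]
    by_cases he : s(y, x) = e
    · have : w.edges.count e = 0 := by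
        refine List.count_eq_zero_of_not_mem fun hm => ?_
        have := w.edges_subset_edgeSet hm
        rw [← he, mem_edgeSet, hH, deleteEdges_adj] at this
        exact this.2 (by simp [Sym2.eq_swap])
      rw [this]; split_ifs <;> omega
    · have := w2 e
      simp [he]; exact this
  · rw [Walk.length_cons]; simp [w3]
  · unfold Phi at hle
    push_cast
    omega

open Classical in
/-- LP weight between two vertex sets. -/
noncomputable def XX (G : SimpleGraph V) (x : Sym2 V → ℝ) (A B : Finset V) : ℝ :=
  dsum (fun a b => if G.Adj a b then x s(a, b) else 0) A B

section claim

variable {G : SimpleGraph V} {x : Sym2 V → ℝ}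

lemma XX_comm (A B : Finset V) : XX G x A B = XX G x B A :=
  dsum_comm _ (fun a b => by
    by_cases h : G.Adj a b
    · simp [h, h.symm, Sym2.eq_swap]
    · have h' : ¬ G.Adj b a := fun k => h k.symm
      simp [h, h']) A B

lemma XX_zero {A B : Finset V} (h : ∀ a ∈ A, ∀ b ∈ B, ¬ G.Adj a b) : XX G x A B = 0 := by
  unfold XX dsum
  refine Finset.sum_eq_zero fun a ha => Finset.sum_eq_zero fun b hb => ?_
  simp [h a ha b hb]

def Good (G : SimpleGraph V) (x : Sym2 V → ℝ) (S : Finset V) : Prop :=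
  ∀ T, T ⊆ S → T.Nonempty → T ≠ S → 2 ≤ XX G x T (S \ T)

lemma Good.left {A B : Finset V} {c d : V} (h : Good G x (A ∪ B)) (hd : Disjoint A B)
    (hBn : B.Nonempty)
    (hu : ∀ a ∈ A, ∀ b ∈ B, G.Adj a b → a = c ∧ b = d) : Good G x A := by
  have key : ∀ U, U ⊆ A → U.Nonempty → c ∉ U → 2 ≤ XX G x U (A \ U) := by
    intro U hU hne hc
    have hUB : Disjoint U B := Finset.disjoint_of_subset_left hU hd
    obtain ⟨b, hb⟩ := hBn
    have := h U (hU.trans Finset.subset_union_left) hne (by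
      rintro rfl
      exact Finset.disjoint_left.1 hUB (Finset.mem_union_right _ hb) hb)
    have e : (A ∪ B) \ U = (A \ U) ∪ B := by
      rw [Finset.union_sdiff_distrib, Finset.sdiff_eq_self_of_disjoint hUB.symm]
    rw [e] at this
    have e2 : XX G x U (A \ U ∪ B) = XX G x U (A \ U) + XX G x U B :=
      dsum_union_right _ _ (Finset.disjoint_of_subset_left Finset.sdiff_subset hd)
    have e3 : XX G x U B = 0 := XX_zero fun a ha b hb hab =>
      hc ((hu a (hU ha) b hb hab).1 ▸ ha)
    linarith
  intro U hU hne hUA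
  by_cases hc : c ∈ U
  · have := key (A \ U) Finset.sdiff_subset
      (by rw [Finset.sdiff_nonempty]; exact fun h => hUA (hU.antisymm h)) (by simp [hc])
    rw [Finset.sdiff_sdiff_eq_self hU, XX_comm] at this
    exact this
  · exact key U hU hne hc

lemma claim (h3 : Sub3 G) (P : (Sym2 V → ℝ) → Prop) {x0 : Sym2 V → ℝ} (hx0 : P x0) :
    ∀ (n : ℕ) (S : Finset V), S.card ≤ n → S.Nonempty → (∀ x, P x → Good G x S) →
      ∃ (a : V) (l : ℕ), Tr G S a a l ∧
        ∀ x, P x → 16 * (l : ℝ) ≤ 21 / 2 * XX G x S S + 5 * (3 * S.card - ee G S S) := by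
  intro n
  induction n with
  | zero =>
    intro S hn hS
    have : S = ∅ := by simpa using hn
    rw [this] at hS; simp at hS
  | succ n ih =>
    intro S hn hS hgood
    obtain ⟨v, hv⟩ := hS
    by_cases hS1 : S = {v}
    · subst hS1
      refine ⟨v, 0, Tr.single v, fun x _ => ?_⟩
      rw [ee_self, XX_zero (by simp)]
      simp
    have hz : ∃ z ∈ S, v ≠ z := by
      by_contra hc
      push Not at hc
      exact hS1 (Finset.eq_singleton_iff_unique_mem.2 ⟨hv, fun z hz => (hc z hz).symm⟩)
    obtain ⟨z, hz, hvz⟩ := hz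
    by_cases hB : Bless G S
    · obtain ⟨a, l, t, hl⟩ := top_bless h3 hB hv hz hvz
      refine ⟨a, l, t, fun x hx => ?_⟩
      have hX : (2 : ℝ) * S.card ≤ XX G x S S := by
        have : ∀ u ∈ S, (2 : ℝ) ≤ XX G x {u} S := by
          intro u hu
          have h1 := hgood x hx {u} (by simpa using hu) (by simp) (by
            rintro h
            rw [← h, Finset.mem_singleton] at hv hz
            exact hvz (hv.trans hz.symm))
          have h2 : XX G x {u} ({u} ∪ (S \ {u})) = XX G x {u} {u} + XX G x {u} (S \ {u}) :=
            dsum_union_right _ _ Finset.disjoint_sdiff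
          rw [Finset.union_sdiff_of_subset (by simpa using hu), XX_zero (A := {u}) (B := {u})
            (by simp)] at h2
          linarith
        have h := Finset.sum_le_sum this
        have h' : ∑ u ∈ S, XX G x {u} S = XX G x S S := by
          unfold XX dsum
          simp
        rw [h', Finset.sum_const, nsmul_eq_mul] at h
        linarith
      have hl' : 16 * (l : ℝ) ≤ 36 * S.card - 5 * ee G S S - 10 := by exact_mod_cast hl
      linarith
    · unfold Bless at hB
      push Not at hB
      obtain ⟨A, hA, hAn, hAS, hlt⟩ := hB
      set B := S \ A with hBdef
      have hd : Disjoint A B := Finset.disjoint_sdiff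
      have hSU : S = A ∪ B := (Finset.union_sdiff_of_subset hA).symm
      have hBn : B.Nonempty := by
        rw [hBdef, Finset.sdiff_nonempty]; exact fun h => hAS (hA.antisymm h)
      have hpos : 1 ≤ ee G A B := by
        by_contra hc
        have h0 := hgood x0 hx0 A hA hAn hAS
        rw [← hBdef, XX_zero] at h0
        · norm_num at h0
        · intro a ha b hb hab
          exact hc (ee_pos ha hb hab)
      have h1 : ee G A B = 1 := by omega
      obtain ⟨c, hc, d, hdB, hcd, hu⟩ := ee_one h1
      have cards : A.card + B.card = S.card := by
        rw [hSU, Finset.card_union_of_disjoint hd]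
      have pA := hAn.card_pos
      have pB := hBn.card_pos
      have gA : ∀ x, P x → Good G x A := fun x hx => by
        have := hgood x hx
        rw [hSU] at this
        exact this.left hd hBn hu
      have gB : ∀ x, P x → Good G x B := fun x hx => by
        have := hgood x hx
        rw [hSU, Finset.union_comm] at this
        exact this.left hd.symm hAn (c := d) (d := c)
          (fun b hb a ha hab => (hu a ha b hb hab.symm).symm)
      obtain ⟨a, l, t, hl⟩ := ih A (by omega) hAn gA
      obtain ⟨a', l', t', hl'⟩ := ih B (by omega) hBn gB
      refine ⟨a, l + l' + 2, ?_, fun x hx => ?_⟩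
      · rw [hSU]; exact t.attach t' hc hdB hcd hd
      · have i1 := hl x hx
        have i2 := hl' x hx
        have i3 := hgood x hx A hA hAn hAS
        rw [← hBdef] at i3
        have eX : XX G x S S = XX G x A A + XX G x B B + 2 * XX G x A B := by
          have q1 : XX G x (A ∪ B) (A ∪ B) = XX G x A (A ∪ B) + XX G x B (A ∪ B) :=
            dsum_union_left _ _ hd
          have q2 : XX G x A (A ∪ B) = XX G x A A + XX G x A B := dsum_union_right _ _ hd
          have q3 : XX G x B (A ∪ B) = XX G x B A + XX G x B B := dsum_union_right _ _ hd
          rw [hSU, q1, q2, q3, XX_comm B A]; ring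
        have eE : ee G S S = ee G A A + ee G B B + 2 := by
          rw [hSU, ee_union_left _ hd, ee_union_right _ hd, ee_union_right _ hd, ee_comm B A, h1]
          ring
        have eC : (S.card : ℝ) = A.card + B.card := by rw [← cards]; push_cast; ring
        rw [eX, eE, eC]
        push_cast
        linarith

end claim

lemma XX_cut [Fintype V] (G : SimpleGraph V) [DecidableRel G.Adj] (x : Sym2 V → ℝ)
    (T : Finset V) :
    ∑ e ∈ G.edgeFinset,
      Set.indicator {e' : Sym2 V | ∃ p q : V, e' = s(p, q) ∧ p ∈ (T : Set V) ∧ q ∉ (T : Set V)} x e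
      = XX G x T (Finset.univ \ T) := by
  classical
  have h1 : XX G x T (Finset.univ \ T) =
      ∑ p ∈ (T ×ˢ (Finset.univ \ T)).filter (fun p => G.Adj p.1 p.2), x s(p.1, p.2) := by
    unfold XX dsum
    rw [Finset.sum_filter, Finset.sum_product]
    refine Finset.sum_congr rfl fun a _ => Finset.sum_congr rfl fun b _ => ?_
    by_cases h : G.Adj a b <;> simp [h]
  rw [h1, ← Finset.sum_image (f := x) (g := fun p : V × V => s(p.1, p.2))]
  · have : ∀ e ∈ G.edgeFinset, Set.indicator
        {e' : Sym2 V | ∃ p q : V, e' = s(p, q) ∧ p ∈ (T : Set V) ∧ q ∉ (T : Set V)} x e =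
        if (∃ p q : V, e = s(p, q) ∧ p ∈ (T : Set V) ∧ q ∉ (T : Set V)) then x e else 0 := by
      intro e _
      rw [Set.indicator_apply]
      rfl
    rw [Finset.sum_congr rfl this, ← Finset.sum_filter]
    refine Finset.sum_congr ?_ fun _ _ => rfl
    ext e
    simp only [Finset.mem_filter, mem_edgeFinset, Finset.mem_image, Finset.mem_product,
      Finset.mem_sdiff, Finset.mem_univ, true_and, Finset.mem_coe, Prod.exists]
    constructor
    · rintro ⟨he, p, q, rfl, hp, hq⟩
      exact ⟨p, q, ⟨⟨hp, hq⟩, he⟩, rfl⟩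
    · rintro ⟨p, q, ⟨⟨hp, hq⟩, he⟩, rfl⟩
      exact ⟨he, p, q, rfl, hp, hq⟩
  · rintro ⟨p, q⟩ hp ⟨p', q'⟩ hp' he
    simp only [Finset.coe_filter, Finset.mem_product, Finset.mem_sdiff, Finset.mem_univ, true_and,
      Set.mem_ofPred_eq] at hp hp'
    simp only [Sym2.eq_iff] at he
    rcases he with ⟨rfl, rfl⟩ | ⟨rfl, rfl⟩
    · rfl
    · exact absurd hp.1.1 hp'.1.2

lemma XX_total [Fintype V] (G : SimpleGraph V) [DecidableRel G.Adj] (x : Sym2 V → ℝ)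
    (hx : ∀ e, 0 ≤ x e) :
    XX G x Finset.univ Finset.univ ≤ 2 * ∑ e ∈ G.edgeFinset, x e := by
  classical
  have h1 : XX G x Finset.univ Finset.univ =
      ∑ p ∈ (Finset.univ : Finset (V × V)).filter (fun p => G.Adj p.1 p.2), x s(p.1, p.2) := by
    unfold XX dsum
    rw [Finset.sum_filter, ← Finset.univ_product_univ, Finset.sum_product]
    refine Finset.sum_congr rfl fun a _ => Finset.sum_congr rfl fun b _ => ?_
    by_cases h : G.Adj a b <;> simp [h]
  rw [h1, ← Finset.sum_fiberwise_of_maps_to (g := fun p : V × V => s(p.1, p.2))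
    (t := G.edgeFinset) (by
      rintro ⟨p, q⟩ h
      simpa using h), Finset.mul_sum]
  refine Finset.sum_le_sum fun e _ => ?_
  rw [Finset.sum_congr rfl (g := fun _ => x e) (fun p hp => by
    rw [(Finset.mem_filter.1 hp).2]), Finset.sum_const, nsmul_eq_mul]
  refine mul_le_mul_of_nonneg_right ?_ (hx e)
  induction e with | _ p q
  have : ((Finset.univ.filter (fun p : V × V => G.Adj p.1 p.2)).filter
      (fun r : V × V => s(r.1, r.2) = s(p, q))).card ≤ ({(p, q), (q, p)} : Finset (V × V)).card := by
    refine Finset.card_le_card fun r hr => ?_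
    have := (Finset.mem_filter.1 hr).2
    rw [Sym2.eq_iff] at this
    simp only [Finset.mem_insert, Finset.mem_singleton, Prod.ext_iff]
    exact this
  exact_mod_cast this.trans Finset.card_le_two

end CubicTour

open CubicTour in
/-- For every connected cubic simple graph `G` there exists a tour of length at most
`(4/3 − 1/183711)·SUB(G)`, where `SUB(G)` is the optimal value of the subtour LP:
the infimum of `∑_{e ∈ E} x_e` over all `x : E → ℝ` with `x ≥ 0` and
`∑_{e ∈ δ(S)} x_e ≥ 2` for every nonempty proper `S ⊆ V`. -/
theorem stmt1 {V : Type*} [Fintype V] [DecidableEq V]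
    (G : SimpleGraph V) [DecidableRel G.Adj]
    (hcubic : ∀ v : V, G.degree v = 3)
    (hconn : G.Connected) :
    ∃ (a : V) (T : G.Walk a a),
      (∀ u : V, u ∈ T.support) ∧
      (∀ e : Sym2 V, T.edges.count e ≤ 2) ∧
      (T.length : ℝ) ≤ (4 / 3 - 1 / 183711) *
        sInf {t : ℝ | ∃ x : Sym2 V → ℝ,
          (∀ e, 0 ≤ x e) ∧
          (∀ S : Set V, S.Nonempty → S ≠ Set.univ →
            2 ≤ ∑ e ∈ G.edgeFinset,
              Set.indicator {e' : Sym2 V | ∃ p q : V, e' = s(p, q) ∧ p ∈ S ∧ q ∉ S} x e) ∧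
          t = ∑ e ∈ G.edgeFinset, x e} := by
  classical
  have hdeg : ∀ v, ee G {v} Finset.univ = 3 := by
    intro v
    have h := hcubic v
    rw [← card_neighborFinset_eq_degree, neighborFinset_eq_filter] at h
    unfold ee dsum
    rw [Finset.sum_singleton]
    have e : (∑ b, if G.Adj v b then (1 : ℤ) else 0) = 3 := by
      rw [Finset.sum_boole, h]; rfl
    convert e
  have h3 : Sub3 G := fun v S => (ee_mono_right _ (Finset.subset_univ S)).trans (hdeg v).le
  have htot : ee G Finset.univ Finset.univ = 3 * (Finset.univ : Finset V).card := by
    have : ee G Finset.univ Finset.univ = ∑ v : V, ee G {v} Finset.univ := by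
      unfold ee dsum
      simp
    rw [this, Finset.sum_congr rfl (fun v _ => hdeg v), Finset.sum_const, nsmul_eq_mul]
    ring
  let P : (Sym2 V → ℝ) → Prop := fun x => (∀ e, 0 ≤ x e) ∧
          (∀ S : Set V, S.Nonempty → S ≠ Set.univ →
            2 ≤ ∑ e ∈ G.edgeFinset,
              Set.indicator {e' : Sym2 V | ∃ p q : V, e' = s(p, q) ∧ p ∈ S ∧ q ∉ S} x e)
  have hP2 : P (fun _ => 2) := by
    refine ⟨fun _ => by norm_num, fun S hS hS' => ?_⟩
    obtain ⟨u, hu⟩ := hS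
    obtain ⟨v, hv⟩ := (Set.ne_univ_iff_exists_notMem S).1 hS'
    obtain ⟨w⟩ := hconn.preconnected u v
    obtain ⟨d, _, hd1, hd2⟩ := w.exists_boundary_dart S hu hv
    have hmem : s(d.fst, d.snd) ∈ G.edgeFinset := mem_edgeFinset.2 d.adj
    refine le_trans ?_ (Finset.single_le_sum (f := fun e => Set.indicator
      {e' : Sym2 V | ∃ p q : V, e' = s(p, q) ∧ p ∈ S ∧ q ∉ S} (fun _ => (2 : ℝ)) e)
      (fun e _ => Set.indicator_nonneg (fun _ _ => by norm_num) e) hmem)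
    rw [Set.indicator_of_mem]
    exact ⟨_, _, rfl, hd1, hd2⟩
  have hgood : ∀ x, P x → Good G x Finset.univ := by
    intro x hx T _ hT hT'
    rw [← XX_cut]
    exact hx.2 T (by simpa using hT) (by simpa using hT')
  obtain ⟨v0⟩ := hconn.nonempty
  obtain ⟨a, l, ⟨w, w1, w2, w3⟩, hl⟩ :=
    claim h3 P hP2 (Finset.univ : Finset V).card Finset.univ le_rfl ⟨v0, by simp⟩ hgood
  refine ⟨a, w, fun u => (w1 u).2 (by simp), fun e => ?_, ?_⟩
  · convert w2 e
  · rw [w3]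
    have hinf : (16 / 21 : ℝ) * l ≤ sInf {t : ℝ | ∃ x : Sym2 V → ℝ,
          (∀ e, 0 ≤ x e) ∧
          (∀ S : Set V, S.Nonempty → S ≠ Set.univ →
            2 ≤ ∑ e ∈ G.edgeFinset,
              Set.indicator {e' : Sym2 V | ∃ p q : V, e' = s(p, q) ∧ p ∈ S ∧ q ∉ S} x e) ∧
          t = ∑ e ∈ G.edgeFinset, x e} := by
      refine le_csInf ⟨_, _, hP2.1, hP2.2, rfl⟩ ?_
      rintro t ⟨x, hx1, hx2, rfl⟩
      have i1 := hl x ⟨hx1, hx2⟩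
      have i2 := XX_total G x hx1
      rw [htot] at i1
      push_cast at i1
      linarith
    have hl0 : (0 : ℝ) ≤ l := Nat.cast_nonneg l
    linarith
end

section
/- Let G = (V,E) be a 2-connected cubic simple graph. Then there exist a positive integer k, perfect matchings M_1, …, M_k of G, each of which intersects every 3-edge-cut of G in exactly one edge, and positive real numbers λ_1, …, λ_k with Σ_{i=1}^k λ_i = 1, such that for every edge e ∈ E one has Σ_{i : e ∈ M_i} λ_i = 1/3. -/
open SimpleGraph

/-- Total weight leaving `T`. -/
noncomputable def Cut {V : Type*} [Fintype V] [DecidableEq V] (x : V → V → ℝ) (T : Finset V) : ℝ :=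
  ∑ u, ∑ v, if u ∈ T ∧ v ∉ T then x u v else 0

/-- Points of Edmonds' perfect matching polytope. -/
structure GoodW {V : Type*} [Fintype V] [DecidableEq V] (x : V → V → ℝ) : Prop where
  symm : ∀ u v, x u v = x v u
  diag : ∀ u, x u u = 0
  nonneg : ∀ u v, 0 ≤ x u v
  sum : ∀ u, ∑ v, x u v = 1
  cut : ∀ T : Finset V, Odd T.card → 1 ≤ Cut x T

/-- Convex hull of perfect matchings. -/
def Dec {V : Type*} [Fintype V] [DecidableEq V] (x : V → V → ℝ) : Prop :=
  ∃ (ι : Type) (_ : Fintype ι) (l : ι → ℝ) (F : ι → V → V),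
    (∀ i, 0 ≤ l i) ∧ (∀ i v, F i (F i v) = v) ∧ (∀ i v, F i v ≠ v) ∧
    ∀ u v, (∑ i, if F i u = v then l i else 0) = x u v

theorem Dec.single {V : Type*} [Fintype V] [DecidableEq V] (f : V → V)
    (h1 : ∀ v, f (f v) = v) (h2 : ∀ v, f v ≠ v) :
    Dec (fun u v => if f u = v then (1 : ℝ) else 0) :=
  ⟨Unit, inferInstance, fun _ => 1, fun _ => f, by simp, by simpa using h1, by simpa using h2, by simp⟩

theorem Dec.comb {V : Type*} [Fintype V] [DecidableEq V] {x y z : V → V → ℝ}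
    (hx : Dec x) (hy : Dec y) (s t : ℝ) (hs : 0 ≤ s) (ht : 0 ≤ t)
    (h : ∀ u v, z u v = s * x u v + t * y u v) : Dec z := by
  obtain ⟨ι, _, l, F, h1, h2, h3, h4⟩ := hx
  obtain ⟨κ, _, m, H, g1, g2, g3, g4⟩ := hy
  refine ⟨ι ⊕ κ, inferInstance, Sum.elim (fun i => s * l i) (fun j => t * m j),
    Sum.elim F H, ?_, ?_, ?_, ?_⟩
  · rintro (i | j)
    · exact mul_nonneg hs (h1 i)
    · exact mul_nonneg ht (g1 j)
  · rintro (i | j)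
    · exact h2 i
    · exact g2 j
  · rintro (i | j)
    · exact h3 i
    · exact g3 j
  · intro u v
    rw [h, ← h4, ← g4, Fintype.sum_sum_type, Finset.mul_sum, Finset.mul_sum]
    simp only [mul_ite, mul_zero]
    rfl

theorem Dec.transport {V W : Type*} [Fintype V] [DecidableEq V] [Fintype W] [DecidableEq W]
    (e : V ≃ W) {x : W → W → ℝ} (h : Dec (fun u v => x (e u) (e v))) : Dec x := by
  obtain ⟨ι, _, l, F, h1, h2, h3, h4⟩ := h
  refine ⟨ι, inferInstance, l, fun i w => e (F i (e.symm w)), h1, ?_, ?_, ?_⟩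
  · intro i v; simp [h2]
  · intro i v hv
    apply h3 i (e.symm v)
    rw [Equiv.eq_symm_apply]; exact hv
  · intro u v
    have := h4 (e.symm u) (e.symm v)
    simp only [Equiv.apply_symm_apply] at this
    rw [← this]
    simp only [Equiv.eq_symm_apply]

/-- Gluing two matchings along a contracted cut. -/
def glueFun {A B : Type*} (f : Option A → Option A) (g : Option B → Option B) (a : A) (b : B) :
    A ⊕ B → A ⊕ B
  | Sum.inl w => match f (some w) with
    | some w' => Sum.inl w'
    | none => Sum.inr b
  | Sum.inr w => match g (some w) with
    | some w' => Sum.inr w'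
    | none => Sum.inl a

theorem sum_fiber {ι A : Type*} [Fintype ι] [Fintype A] [DecidableEq A] (l : ι → ℝ) (a : ι → A)
    (p r : A → ℝ) (hp : ∀ c, (∑ i, if a i = c then l i else 0) = p c)
    (hr : ∀ c, p c = 0 → r c = 0) :
    ∑ i, l i * r (a i) / p (a i) = ∑ c, r c := by
  have : ∀ i, l i * r (a i) / p (a i) = ∑ c, (if a i = c then l i else 0) * (r c / p c) := by
    intro i
    simp [ite_mul, mul_div_assoc]
  simp_rw [this]
  rw [Finset.sum_comm]
  refine Finset.sum_congr rfl fun c _ => ?_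
  rw [← Finset.sum_mul, hp]
  by_cases h : p c = 0
  · simp [h, hr c h]
  · field_simp

theorem Dec.glue {A B : Type*} [Fintype A] [DecidableEq A] [Fintype B] [DecidableEq B]
    {x : A ⊕ B → A ⊕ B → ℝ} (hs : ∀ u v, x u v = x v u) (h0 : ∀ u v, 0 ≤ x u v)
    {y : Option A → Option A → ℝ} {z : Option B → Option B → ℝ}
    (hy : Dec y) (hz : Dec z)
    (y1 : ∀ a b, y (some a) (some b) = x (Sum.inl a) (Sum.inl b))
    (y2 : ∀ a, y none (some a) = ∑ b, x (Sum.inl a) (Sum.inr b))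
    (z1 : ∀ a b, z (some a) (some b) = x (Sum.inr a) (Sum.inr b))
    (z2 : ∀ b, z none (some b) = ∑ a, x (Sum.inl a) (Sum.inr b)) : Dec x := by
  obtain ⟨ι, _, l, F, h1, h2, h3, h4⟩ := hy
  obtain ⟨κ, _, m, H, g1, g2, g3, g4⟩ := hz
  have ha : ∀ i, ∃ a, F i none = some a := fun i => by
    have := h3 i none
    exact Option.ne_none_iff_exists'.mp this
  have hb : ∀ i, ∃ a, H i none = some a := fun i => by
    have := g3 i none
    exact Option.ne_none_iff_exists'.mp this
  choose a ha using ha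
  choose b hb using hb
  set p : A → ℝ := fun a => ∑ b, x (Sum.inl a) (Sum.inr b) with hp
  set q : B → ℝ := fun b => ∑ a, x (Sum.inl a) (Sum.inr b) with hq
  have hpl : ∀ c, (∑ i, if a i = c then l i else 0) = p c := by
    intro c
    rw [hp]; simp only
    rw [← y2, ← h4]; simp [ha]
  have hqm : ∀ c, (∑ i, if b i = c then m i else 0) = q c := by
    intro c
    rw [hq]; simp only
    rw [← z2, ← g4]; simp [hb]
  have hp0 : ∀ c d, p c = 0 → x (Sum.inl c) (Sum.inr d) = 0 := by
    intro c d h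
    exact (Finset.sum_eq_zero_iff_of_nonneg (fun _ _ => h0 _ _)).1 h d (Finset.mem_univ _)
  have hq0 : ∀ c d, q d = 0 → x (Sum.inl c) (Sum.inr d) = 0 := by
    intro c d h
    exact (Finset.sum_eq_zero_iff_of_nonneg (fun _ _ => h0 _ _)).1 h c (Finset.mem_univ _)
  have hl0 : ∀ i, p (a i) = 0 → l i = 0 := by
    intro i h
    rw [← hpl] at h
    have := (Finset.sum_eq_zero_iff_of_nonneg (fun j _ => by split_ifs <;> simp [h1])).1 h i
      (Finset.mem_univ _)
    simpa using this
  have hm0 : ∀ i, q (b i) = 0 → m i = 0 := by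
    intro i h
    rw [← hqm] at h
    have := (Finset.sum_eq_zero_iff_of_nonneg (fun j _ => by split_ifs <;> simp [g1])).1 h i
      (Finset.mem_univ _)
    simpa using this
  set w : ι × κ → ℝ := fun ij => l ij.1 * m ij.2 * x (Sum.inl (a ij.1)) (Sum.inr (b ij.2)) /
    (p (a ij.1) * q (b ij.2)) with hw
  have hw1 : ∀ i, ∑ j, w (i, j) = l i := by
    intro i
    have := sum_fiber m b q (fun d => x (Sum.inl (a i)) (Sum.inr d)) hqm (fun d => hq0 _ d)
    have e : ∀ j, w (i, j) = l i / p (a i) * (m j * x (Sum.inl (a i)) (Sum.inr (b j)) / q (b j)) := by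
      intro j; simp only [hw]; rw [div_mul_div_comm]; ring
    simp_rw [e]
    rw [← Finset.mul_sum, this]
    change l i / p (a i) * p (a i) = l i
    by_cases h : p (a i) = 0
    · simp [h, hl0 i h]
    · field_simp
  have hw2 : ∀ j, ∑ i, w (i, j) = m j := by
    intro j
    have := sum_fiber l a p (fun d => x (Sum.inl d) (Sum.inr (b j))) hpl (fun d => hp0 d _)
    have e : ∀ i, w (i, j) = m j / q (b j) * (l i * x (Sum.inl (a i)) (Sum.inr (b j)) / p (a i)) := by
      intro i; simp only [hw]; rw [div_mul_div_comm]; ring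
    simp_rw [e]
    rw [← Finset.mul_sum, this]
    change m j / q (b j) * q (b j) = m j
    by_cases h : q (b j) = 0
    · simp [h, hm0 j h]
    · field_simp
  have hw3 : ∀ c d, (∑ i, ∑ j, if a i = c ∧ b j = d then w (i, j) else 0) =
      x (Sum.inl c) (Sum.inr d) := by
    intro c d
    have e : ∀ i j, (if a i = c ∧ b j = d then w (i, j) else 0) =
      (if a i = c then l i else 0) * ((if b j = d then m j else 0) *
        (x (Sum.inl c) (Sum.inr d) / (p c * q d))) := by
      intro i j
      by_cases h : a i = c <;> by_cases h' : b j = d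
      · subst h h'; simp [hw]; ring
      all_goals simp [h, h']
    simp_rw [e, ← Finset.mul_sum, ← Finset.sum_mul]
    rw [hpl, hqm]
    by_cases hc : p c = 0
    · simp [hc, hp0 c d hc]
    by_cases hd : q d = 0
    · simp [hd, hq0 c d hd]
    field_simp
  have hFa : ∀ i c, F i (some c) = none ↔ a i = c := by
    intro i c
    constructor
    · intro h
      have := h2 i (some c)
      rw [h, ha] at this; simpa using this
    · rintro rfl
      rw [← ha, h2]
  have hHb : ∀ i c, H i (some c) = none ↔ b i = c := by
    intro i c
    constructor
    · intro h
      have := g2 i (some c)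
      rw [h, hb] at this; simpa using this
    · rintro rfl
      rw [← hb, g2]
  have k1 : ∀ i j c d, glueFun (F i) (H j) (a i) (b j) (Sum.inl c) = Sum.inl d ↔
      F i (some c) = some d := by
    intro i j c d
    simp only [glueFun]
    cases h : F i (some c) <;> simp
  have k2 : ∀ i j c d, glueFun (F i) (H j) (a i) (b j) (Sum.inl c) = Sum.inr d ↔
      a i = c ∧ b j = d := by
    intro i j c d
    simp only [glueFun]
    rw [← hFa]
    cases h : F i (some c) <;> simp
  have k3 : ∀ i j c d, glueFun (F i) (H j) (a i) (b j) (Sum.inr c) = Sum.inr d ↔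
      H j (some c) = some d := by
    intro i j c d
    simp only [glueFun]
    cases h : H j (some c) <;> simp
  have k4 : ∀ i j c d, glueFun (F i) (H j) (a i) (b j) (Sum.inr c) = Sum.inl d ↔
      a i = d ∧ b j = c := by
    intro i j c d
    simp only [glueFun]
    rw [← hHb]
    cases h : H j (some c) <;> simp
  refine ⟨ι × κ, inferInstance, w, fun ij => glueFun (F ij.1) (H ij.2) (a ij.1) (b ij.2),
    ?_, ?_, ?_, ?_⟩
  · intro ij
    have hpp : ∀ c, 0 ≤ p c := fun c => Finset.sum_nonneg fun _ _ => h0 _ _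
    have hqq : ∀ c, 0 ≤ q c := fun c => Finset.sum_nonneg fun _ _ => h0 _ _
    exact div_nonneg (mul_nonneg (mul_nonneg (h1 _) (g1 _)) (h0 _ _)) (mul_nonneg (hpp _) (hqq _))
  · rintro ⟨i, j⟩ (c | c)
    · simp only
      rcases hh : glueFun (F i) (H j) (a i) (b j) (Sum.inl c) with d | d
      · rw [k1] at hh ⊢; rw [← hh, h2]
      · rw [k2] at hh; rw [k4]; exact hh
    · simp only
      rcases hh : glueFun (F i) (H j) (a i) (b j) (Sum.inr c) with d | d
      · rw [k4] at hh; rw [k2]; exact hh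
      · rw [k3] at hh ⊢; rw [← hh, g2]
  · rintro ⟨i, j⟩ (c | c)
    · simp only [ne_eq, k1]; exact h3 i _
    · simp only [ne_eq, k3]; exact g3 j _
  · rintro (c | c) (d | d)
    · rw [Fintype.sum_prod_type]
      simp only [k1]
      rw [← y1, ← h4]
      refine Finset.sum_congr rfl fun i _ => ?_
      split_ifs
      · exact hw1 i
      · simp
    · rw [Fintype.sum_prod_type]
      simp only [k2]
      exact hw3 c d
    · rw [Fintype.sum_prod_type]
      simp only [k4]
      rw [hw3 d c, hs]
    · rw [Fintype.sum_prod_type_right]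
      simp only [k3]
      rw [← z1, ← g4]
      refine Finset.sum_congr rfl fun i _ => ?_
      split_ifs
      · exact hw2 i
      · simp

/-- Contraction along a map. -/
noncomputable def contr {V W : Type*} [Fintype V] [DecidableEq W] (π : V → W)
    (x : V → V → ℝ) : W → W → ℝ :=
  fun a b => if a = b then 0 else ∑ u, ∑ v, if π u = a ∧ π v = b then x u v else 0

theorem cut_contr {V W : Type*} [Fintype V] [DecidableEq V] [Fintype W] [DecidableEq W] (π : V → W)
    (x : V → V → ℝ) (T : Finset W) :
    Cut (contr π x) T = Cut x (Finset.univ.filter fun v => π v ∈ T) := by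
  unfold Cut
  have e : ∀ a b, (if a ∈ T ∧ b ∉ T then contr π x a b else 0) =
      ∑ uv : V × V, if π uv.1 = a ∧ π uv.2 = b then
        (if a ∈ T ∧ b ∉ T then x uv.1 uv.2 else 0) else 0 := by
    intro a b
    by_cases h : a ∈ T ∧ b ∉ T
    · have hab : a ≠ b := by rintro rfl; exact h.2 h.1
      rw [Fintype.sum_prod_type]
      simp only [h, contr, hab]; simp
    · simp [h]
  simp_rw [e]
  rw [← Fintype.sum_prod_type' (f := fun a b => ∑ uv : V × V, if π uv.1 = a ∧ π uv.2 = b then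
        (if a ∈ T ∧ b ∉ T then x uv.1 uv.2 else 0) else 0), Finset.sum_comm,
    Fintype.sum_prod_type]
  refine Finset.sum_congr rfl fun u _ => Finset.sum_congr rfl fun v _ => ?_
  rw [Fintype.sum_prod_type]
  rw [Finset.sum_eq_single (π u), Finset.sum_eq_single (π v)]
  · simp
  · intro b _ hb; simp [hb.symm]
  · simp
  · intro b _ hb; simp [hb.symm]
  · simp

theorem cut_singleton {V : Type*} [Fintype V] [DecidableEq V] (x : V → V → ℝ) (a : V)
    (h : x a a = 0) : Cut x {a} = ∑ v, x a v := by
  unfold Cut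
  rw [Finset.sum_eq_single a]
  · refine Finset.sum_congr rfl fun v _ => ?_
    by_cases hv : v = a
    · subst hv; simp [h]
    · simp [hv]
  · intro b _ hb; simp [hb]
  · simp

theorem cut_compl {V : Type*} [Fintype V] [DecidableEq V] (x : V → V → ℝ)
    (h : ∀ u v, x u v = x v u) (T : Finset V) : Cut x Tᶜ = Cut x T := by
  unfold Cut
  rw [Finset.sum_comm]
  refine Finset.sum_congr rfl fun u _ => Finset.sum_congr rfl fun v _ => ?_
  rw [h v u]
  simp [and_comm]

theorem GoodW.even {V : Type*} [Fintype V] [DecidableEq V] {x : V → V → ℝ} (hx : GoodW x) :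
    Even (Fintype.card V) := by
  by_contra h
  rw [Nat.not_even_iff_odd] at h
  have := hx.cut Finset.univ (by simpa using h)
  unfold Cut at this
  simp at this
  linarith

theorem GoodW.contr {V W : Type*} [Fintype V] [DecidableEq V] [Fintype W] [DecidableEq W] (π : V → W)
    {x : V → V → ℝ} (hx : GoodW x)
    (hodd : ∀ a, Odd (Finset.univ.filter fun v => π v = a).card)
    (ht : ∀ a, Cut x (Finset.univ.filter fun v => π v = a) = 1) : GoodW (contr π x) where
  symm := by
    intro a b
    unfold _root_.contr
    by_cases h : a = b
    · simp [h]
    · rw [if_neg h, if_neg (Ne.symm h), Finset.sum_comm]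
      refine Finset.sum_congr rfl fun u _ => Finset.sum_congr rfl fun v _ => ?_
      rw [hx.symm v u]
      simp [and_comm]
  diag := by intro a; simp [_root_.contr]
  nonneg := by
    intro a b
    unfold _root_.contr
    split_ifs
    · rfl
    · refine Finset.sum_nonneg fun u _ => Finset.sum_nonneg fun v _ => ?_
      split_ifs
      · exact hx.nonneg _ _
      · rfl
  sum := by
    intro a
    rw [← cut_singleton _ a (by simp [_root_.contr]), cut_contr]
    simpa using ht a
  cut := by
    intro T hT
    rw [cut_contr]
    apply hx.cut
    rw [Finset.card_eq_sum_card_fiberwise (f := π) (t := T) (by intro v hv; simpa using hv),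
      Finset.odd_sum_iff_odd_card_odd, Finset.filter_true_of_mem]
    · exact hT
    · intro a ha
      convert hodd a using 2
      ext v; simp only [Finset.mem_filter, Finset.mem_univ, true_and]
      constructor
      · exact fun h => h.2
      · rintro rfl; exact ⟨ha, rfl⟩

/-- Contract the complement of `P` to one vertex. -/
def proj {V : Type*} (P : V → Prop) [DecidablePred P] (v : V) : Option {v // P v} :=
  if h : P v then some ⟨v, h⟩ else none

theorem proj_some {V : Type*} (P : V → Prop) [DecidablePred P] (v : V) (a : {v // P v}) :
    proj P v = some a ↔ v = a := by
  unfold proj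
  split_ifs with h
  · simp [Subtype.ext_iff]
  · simp; rintro rfl; exact h a.2

theorem proj_none {V : Type*} (P : V → Prop) [DecidablePred P] (v : V) :
    proj P v = none ↔ ¬ P v := by
  unfold proj
  split_ifs with h <;> simp [h]

theorem GoodW.proj {V : Type*} [Fintype V] [DecidableEq V] {x : V → V → ℝ} (hx : GoodW x)
    (P : V → Prop) [DecidablePred P] (ho : Odd (Finset.univ.filter fun v => ¬ P v).card)
    (ht : Cut x (Finset.univ.filter fun v => ¬ P v) = 1) :
    GoodW (_root_.contr (_root_.proj P) x) := by
  apply hx.contr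
  · rintro (_ | a)
    · simpa only [proj_none] using ho
    · simp [proj_some, Finset.filter_eq']
  · rintro (_ | a)
    · simpa only [proj_none] using ht
    · simp only [proj_some, Finset.filter_eq']
      simp only [Finset.mem_univ, if_true]
      rw [cut_singleton _ _ (hx.diag _), hx.sum]

theorem contr_some {V : Type*} [Fintype V] [DecidableEq V] {x : V → V → ℝ} (hx : GoodW x)
    (P : V → Prop) [DecidablePred P] (a b : {v // P v}) :
    contr (proj P) x (some a) (some b) = x a b := by
  unfold contr
  by_cases h : a = b
  · subst h; simp [hx.diag]
  · simp only [proj_some, Option.some.injEq, h, if_false]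
    rw [Finset.sum_eq_single a.1, Finset.sum_eq_single b.1]
    · simp
    · intro c _ hc; simp [hc]
    · simp
    · intro c _ hc; simp [hc]
    · simp

theorem contr_none {V : Type*} [Fintype V] [DecidableEq V] {x : V → V → ℝ}
    (P : V → Prop) [DecidablePred P] (a : {v // P v}) :
    contr (proj P) x none (some a) = ∑ u : {v // ¬ P v}, x u a := by
  unfold contr
  simp only [proj_some, proj_none, reduceCtorEq, if_false]
  have : ∀ u, (∑ v, if ¬ P u ∧ v = a.1 then x u v else 0) = if ¬ P u then x u a else 0 := by
    intro u
    rw [Finset.sum_eq_single a.1]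
    · simp
    · intro c _ hc; simp [hc]
    · simp
  simp_rw [this]
  rw [← Finset.sum_filter]
  exact Finset.sum_subtype _ (by simp) _

theorem GoodW.dec_of_tight {V : Type*} [Fintype V] [DecidableEq V] {x : V → V → ℝ} (hx : GoodW x)
    (P : V → Prop) [DecidablePred P] (ho : Odd (Finset.univ.filter P).card)
    (ht : Cut x (Finset.univ.filter P) = 1)
    (h1 : GoodW (_root_.contr (_root_.proj P) x) → Dec (_root_.contr (_root_.proj P) x))
    (h2 : GoodW (_root_.contr (_root_.proj (fun v => ¬ P v)) x) →
      Dec (_root_.contr (_root_.proj (fun v => ¬ P v)) x)) :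
    Dec x := by
  have e1 : (Finset.univ.filter fun v => ¬ P v) = (Finset.univ.filter P)ᶜ := by ext; simp
  have e2 : (Finset.univ.filter fun v => ¬ ¬ P v) = (Finset.univ.filter P) := by ext; simp
  have hoc : Odd ((Finset.univ.filter P)ᶜ).card := by
    have := hx.even
    have h3 := Finset.card_add_card_compl (Finset.univ.filter P)
    rw [← h3] at this
    rw [Nat.even_add] at this
    rw [← Nat.not_even_iff_odd] at ho ⊢
    tauto
  have d1 := h1 (hx.proj _ (by rw [e1]; exact hoc) (by rw [e1, cut_compl _ hx.symm, ht]))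
  have d2 := h2 (hx.proj _ (by rw [e2]; exact ho) (by rw [e2, ht]))
  apply Dec.transport (Equiv.sumCompl P)
  refine Dec.glue (fun u v => hx.symm _ _) (fun u v => hx.nonneg _ _) d1 d2 ?_ ?_ ?_ ?_
  · intro a b
    rw [contr_some hx]; simp
  · intro a
    rw [contr_none]
    exact Finset.sum_congr rfl fun b _ => hx.symm _ _
  · intro a b
    rw [contr_some hx]; simp
  · intro a
    rw [contr_none]
    rw [← Finset.sum_subtype (p := fun v => ¬ ¬ P v) (Finset.univ.filter P) (by simp)
        (fun u => x u a),
      Finset.sum_subtype (p := P) (Finset.univ.filter P) (by simp) (fun u => x u a)]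
    rfl

theorem min_ratio {I : Type*} [Fintype I] (p q : I → ℝ) (hp : ∀ i, 0 ≤ p i) (hq : ∃ i, q i < 0) :
    ∃ t : ℝ, 0 ≤ t ∧ (∀ i, 0 ≤ p i + t * q i) ∧ ∃ j, q j < 0 ∧ p j + t * q j = 0 := by
  classical
  obtain ⟨i0, h0⟩ := hq
  obtain ⟨j, hj, hm⟩ := Finset.exists_min_image (Finset.univ.filter fun i => q i < 0)
    (fun i => p i / (- q i)) ⟨i0, by simpa using h0⟩
  have hj : q j < 0 := by simpa using hj
  have ht : 0 ≤ p j / (- q j) := div_nonneg (hp j) (by linarith)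
  refine ⟨p j / (- q j), ht, ?_, j, hj, ?_⟩
  · intro i
    by_cases hi : q i < 0
    · have := hm i (by simpa using hi)
      rw [le_div_iff₀ (by linarith)] at this
      linarith
    · have := mul_nonneg ht (not_lt.1 hi)
      linarith [hp i]
  · have : q j ≠ 0 := hj.ne
    field_simp; ring

theorem GoodW.matching {V : Type*} [Fintype V] [DecidableEq V] {x : V → V → ℝ} (hx : GoodW x) :
    ∃ f : V → V, (∀ v, f (f v) = v) ∧ (∀ v, f v ≠ v) ∧ ∀ v, 0 < x v (f v) := by
  classical
  let H : SimpleGraph V :=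
    { Adj := fun u v => 0 < x u v
      symm := ⟨fun u v h => by rw [hx.symm]; exact h⟩
      loopless := ⟨fun u h => by rw [hx.diag] at h; exact lt_irrefl _ h⟩ }
  have key : ∀ U : Set V, ¬ H.IsTutteViolator U := by
    intro U hU
    unfold IsTutteViolator at hU
    set K := ((⊤ : H.Subgraph).deleteVerts U) with hK
    let T : K.coe.ConnectedComponent → Finset V := fun c =>
      Finset.univ.filter fun v => ∃ h : v ∈ K.verts, (⟨v, h⟩ : K.verts) ∈ c.supp
    have hTc : ∀ c, (T c).card = c.supp.ncard := by
      intro c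
      rw [← Set.ncard_coe_finset, ← Set.ncard_image_of_injective c.supp Subtype.val_injective]
      congr 1
      ext v; simp [T]
    let r : V → ℝ := fun u => ∑ v, if v ∈ U then x u v else 0
    have hr0 : ∀ u, 0 ≤ r u := fun u => Finset.sum_nonneg fun v _ => by
      split_ifs
      · exact hx.nonneg _ _
      · rfl
    have hr : ∑ u, r u = U.ncard := by
      simp only [r]
      rw [Finset.sum_comm]
      have : ∀ v, (∑ u, if v ∈ U then x u v else 0) = if v ∈ U then 1 else 0 := by
        intro v
        split_ifs
        · rw [← hx.sum v]; exact Finset.sum_congr rfl fun u _ => hx.symm _ _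
        · simp
      simp_rw [this]
      rw [Finset.sum_boole, ← Set.ncard_coe_finset]
      simp
    have hcut : ∀ c, Cut x (T c) ≤ ∑ u, if u ∈ T c then r u else 0 := by
      intro c
      unfold Cut
      refine Finset.sum_le_sum fun u _ => ?_
      by_cases hu : u ∈ T c
      · simp only [hu, true_and, if_true, r]
        refine Finset.sum_le_sum fun v _ => ?_
        by_cases hv : v ∈ T c
        · simp only [hv]
          simp
          split_ifs
          · exact hx.nonneg _ _
          · rfl
        · simp only [hv]
          simp
          split_ifs with hvU
          · rfl
          · by_contra hpos
            push Not at hpos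
            apply hv
            simp only [T, Finset.mem_filter, Finset.mem_univ, true_and] at hu ⊢
            obtain ⟨hu1, hu2⟩ := hu
            have hv1 : v ∈ K.verts := by simp [hK, hvU]
            refine ⟨hv1, ?_⟩
            have hadj : K.coe.Adj ⟨u, hu1⟩ ⟨v, hv1⟩ := by
              have : u ∉ U := by simpa [hK] using hu1
              simp [hK, hvU, this]
              exact hpos
            exact c.mem_supp_of_adj_mem_supp hu2 hadj
      · simp [hu]
    let O := Finset.univ.filter fun c => c ∈ K.coe.oddComponents
    have hO : K.coe.oddComponents.ncard = O.card := by
      rw [← Set.ncard_coe_finset]; simp [O]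
    have c1 : (O.card : ℝ) ≤ ∑ c ∈ O, Cut x (T c) := by
      rw [Finset.card_eq_sum_ones]; push_cast
      refine Finset.sum_le_sum fun c hc => hx.cut _ ?_
      rw [hTc]
      simpa [O] using hc
    have c2 : ∑ c ∈ O, Cut x (T c) ≤ ∑ u, r u := by
      refine (Finset.sum_le_sum fun c _ => hcut c).trans ?_
      rw [Finset.sum_comm]
      refine Finset.sum_le_sum fun u _ => ?_
      rw [← Finset.sum_filter, Finset.sum_const, nsmul_eq_mul]
      have : (O.filter fun c => u ∈ T c).card ≤ 1 := by
        rw [Finset.card_le_one]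
        intro c hc d hd
        simp only [T, Finset.mem_filter, Finset.mem_univ, true_and] at hc hd
        obtain ⟨_, _, h1⟩ := hc
        obtain ⟨_, _, h2⟩ := hd
        rw [ConnectedComponent.mem_supp_iff] at h1 h2
        rw [← h1, ← h2]
      have : ((O.filter fun c => u ∈ T c).card : ℝ) ≤ 1 := by exact_mod_cast this
      nlinarith [hr0 u]
    rw [hr] at c2
    rw [hO] at hU
    have : (O.card : ℝ) ≤ U.ncard := c1.trans c2
    have : O.card ≤ U.ncard := by exact_mod_cast this
    omega
  obtain ⟨M, hM⟩ := SimpleGraph.tutte.2 key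
  rw [Subgraph.isPerfectMatching_iff] at hM
  choose f hf hu using hM
  refine ⟨f, fun v => (hu _ _ (hf v).symm).symm, fun v hv => ?_, fun v => (hf v).adj_sub⟩
  have := hf v
  rw [hv] at this
  exact this.ne rfl

theorem cut_one {V : Type*} [Fintype V] [DecidableEq V] {x : V → V → ℝ}
    (hd : ∀ u, x u u = 0) (h1 : ∀ u, ∑ v, x u v = 1) (T : Finset V) (hT : T.card = 1) :
    Cut x T = 1 := by
  obtain ⟨a, rfl⟩ := Finset.card_eq_one.1 hT
  rw [cut_singleton _ _ (hd a), h1]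

theorem GoodW.step {V : Type*} [Fintype V] [DecidableEq V] {x : V → V → ℝ} (hx : GoodW x) :
    Dec x ∨ ∃ (y m : V → V → ℝ) (t : ℝ), 0 ≤ t ∧ GoodW y ∧ Dec m ∧
      (∀ u v, (1 + t) * x u v = y u v + t * m u v) ∧
      (((Finset.univ.filter fun p : V × V => y p.1 p.2 ≠ 0).card <
        (Finset.univ.filter fun p : V × V => x p.1 p.2 ≠ 0).card) ∨
        ∃ T : Finset V, Odd T.card ∧ Cut y T = 1 ∧ 1 < T.card ∧ 1 < Tᶜ.card) := by
  classical
  obtain ⟨f, f1, f2, f3⟩ := hx.matching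
  set m : V → V → ℝ := fun u v => if f u = v then (1 : ℝ) else 0 with hm
  have hmD : Dec m := Dec.single f f1 f2
  have msymm : ∀ u v, m u v = m v u := by
    intro u v
    have : f u = v ↔ f v = u := by
      constructor
      · rintro rfl; exact f1 u
      · rintro rfl; exact f1 v
    simp [hm, this]
  have mdiag : ∀ u, m u u = 0 := by intro u; simp [hm, f2]
  have msum : ∀ u, ∑ v, m u v = 1 := by intro u; simp [hm]
  by_cases hall : ∃ u, x u (f u) < 1
  swap
  · left
    push Not at hall
    have : x = m := by
      funext u v
      have hs := hx.sum u
      rw [← Finset.add_sum_erase _ _ (Finset.mem_univ (f u))] at hs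
      have hn : 0 ≤ ∑ v ∈ Finset.univ.erase (f u), x u v :=
        Finset.sum_nonneg fun v _ => hx.nonneg _ _
      have h1 := hall u
      have hz : ∑ v ∈ Finset.univ.erase (f u), x u v = 0 := by linarith
      by_cases hv : f u = v
      · subst hv; simp [hm]; linarith
      · rw [Finset.sum_eq_zero_iff_of_nonneg (fun v _ => hx.nonneg _ _)] at hz
        rw [hz v (by simp [Ne.symm hv])]
        simp [hm, hv]
    rw [this]; exact hmD
  right
  obtain ⟨u0, hu0⟩ := hall
  let p : (V × V) ⊕ Finset V → ℝ := Sum.elim (fun e => x e.1 e.2)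
    (fun T => if Odd T.card then Cut x T - 1 else 0)
  let q : (V × V) ⊕ Finset V → ℝ := Sum.elim (fun e => x e.1 e.2 - m e.1 e.2)
    (fun T => if Odd T.card then Cut x T - Cut m T else 0)
  obtain ⟨t, ht, hall, j, hj1, hj2⟩ := min_ratio p q (by
      rintro (e | T)
      · exact hx.nonneg _ _
      · simp only [p, Sum.elim_inr]
        split_ifs with h
        · linarith [hx.cut T h]
        · rfl) ⟨Sum.inl (u0, f u0), by simp [q, hm, hu0]⟩
  set y : V → V → ℝ := fun u v => (1 + t) * x u v - t * m u v with hy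
  have hcy : ∀ T, Cut y T = (1 + t) * Cut x T - t * Cut m T := by
    intro T
    unfold Cut
    rw [Finset.mul_sum, Finset.mul_sum, ← Finset.sum_sub_distrib]
    refine Finset.sum_congr rfl fun u _ => ?_
    rw [Finset.mul_sum, Finset.mul_sum, ← Finset.sum_sub_distrib]
    refine Finset.sum_congr rfl fun v _ => ?_
    split_ifs <;> simp [hy]
  have gy : GoodW y := by
    refine ⟨?_, ?_, ?_, ?_, ?_⟩
    · intro u v; simp only [hy]; rw [hx.symm, msymm]
    · intro u; simp only [hy]; rw [hx.diag, mdiag]; simp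
    · intro u v
      have := hall (Sum.inl (u, v))
      simp only [p, q, Sum.elim_inl] at this
      simp only [hy]; linarith
    · intro u
      simp only [hy]
      rw [Finset.sum_sub_distrib, ← Finset.mul_sum, ← Finset.mul_sum, hx.sum, msum]; ring
    · intro T hT
      have := hall (Sum.inr T)
      simp only [p, q, Sum.elim_inr, hT, if_true] at this
      rw [hcy]; linarith
  refine ⟨y, m, t, ht, gy, hmD, fun u v => by simp only [hy]; ring, ?_⟩
  rcases j with ⟨u, v⟩ | T
  · left
    simp only [p, q, Sum.elim_inl] at hj1 hj2
    have hfu : f u = v := by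
      by_contra h
      have := hx.nonneg u v
      simp [hm, h] at hj1
      linarith
    apply Finset.card_lt_card
    rw [Finset.ssubset_iff_of_subset]
    · refine ⟨(u, v), ?_, ?_⟩
      · simp; rw [← hfu]; exact (f3 u).ne'
      · simp [hy]; linarith
    · rintro ⟨a, b⟩ hab
      simp only [Finset.mem_filter, Finset.mem_univ, true_and] at hab ⊢
      intro h0
      apply hab
      have : f a ≠ b := by
        rintro rfl
        exact (f3 a).ne' h0
      simp [hy, h0, hm, this]
  · right
    simp only [p, q, Sum.elim_inr] at hj1 hj2
    split_ifs at hj1 hj2 with hT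
    · have hTc : Odd Tᶜ.card := by
        have := hx.even
        have h3 := Finset.card_add_card_compl T
        rw [← h3, Nat.even_add] at this
        rw [← Nat.not_even_iff_odd] at hT ⊢
        tauto
      refine ⟨T, hT, by rw [hcy]; linarith, ?_, ?_⟩
      · by_contra h
        have h1 : T.card = 1 := by have := hT.pos; omega
        rw [cut_one hx.diag hx.sum T h1, cut_one mdiag msum T h1] at hj1
        simp at hj1
      · by_contra h
        have h1 : Tᶜ.card = 1 := by have := hTc.pos; omega
        rw [← cut_compl x hx.symm, ← cut_compl m msymm, cut_one hx.diag hx.sum _ h1,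
          cut_one mdiag msum _ h1] at hj1
        simp at hj1
    · simp at hj1

theorem GoodW.dec : ∀ (n k : ℕ) {V : Type*} [Fintype V] [DecidableEq V] {x : V → V → ℝ},
    Fintype.card V = n → (Finset.univ.filter fun p : V × V => x p.1 p.2 ≠ 0).card = k →
    GoodW x → Dec x := by
  intro n
  induction n using Nat.strong_induction_on with
  | _ n ihn =>
  intro k
  induction k using Nat.strong_induction_on with
  | _ k ihk =>
  intro V _ _ x hn hk hx
  rcases hx.step with h | ⟨y, m, t, ht, gy, hm, hxy, h⟩
  · exact h
  have hyD : Dec y := by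
    rcases h with h | ⟨T, hT, hc, h1, h2⟩
    · exact ihk _ (hk ▸ h) hn rfl gy
    · classical
      obtain ⟨P, hP⟩ : ∃ P : V → Prop, ∀ v, P v ↔ v ∈ T := ⟨fun v => v ∈ T, fun _ => Iff.rfl⟩
      have eT : Finset.univ.filter P = T := by ext; simp [hP]
      have hcard := Finset.card_add_card_compl T
      have c2 : Fintype.card {v // ¬ P v} = Tᶜ.card := by
        rw [Fintype.card_subtype]; congr 1; ext; simp [hP]
      refine gy.dec_of_tight P (by rw [eT]; exact hT) (by rw [eT]; exact hc) ?_ ?_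
      · refine ihn _ ?_ _ rfl rfl
        rw [Fintype.card_option, Fintype.card_subtype, eT]; omega
      · refine ihn _ ?_ _ rfl rfl
        rw [Fintype.card_option, c2]; omega
  have h1t : (0 : ℝ) < 1 + t := by linarith
  refine hyD.comb hm (1 / (1 + t)) (t / (1 + t)) (by positivity) (by positivity) fun u v => ?_
  have := hxy u v
  field_simp
  linarith

theorem even_of_involution {α : Type*} (s : Finset α) (g : α → α)
    (h1 : ∀ a ∈ s, g a ∈ s) (h2 : ∀ a ∈ s, g (g a) = a) (h3 : ∀ a ∈ s, g a ≠ a) :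
    Even s.card := by
  have : ∑ a ∈ s, (1 : ZMod 2) = 0 :=
    Finset.sum_involution (fun a _ => g a) (fun _ _ => by decide) (fun a ha _ => h3 a ha)
      h1 h2
  simp only [Finset.sum_const, nsmul_eq_mul, mul_one] at this
  rwa [ZMod.natCast_eq_zero_iff_even] at this

section Main

variable {V : Type*} [Fintype V] [DecidableEq V] (G : SimpleGraph V) [DecidableRel G.Adj]

/-- Directed crossing edges. -/
def crossing (T : Finset V) : Finset (V × V) :=
  Finset.univ.filter fun p => p.1 ∈ T ∧ p.2 ∉ T ∧ G.Adj p.1 p.2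

theorem crossing_parity (hcubic : ∀ v : V, G.degree v = 3) (T : Finset V) :
    Odd (crossing G T).card ↔ Odd T.card := by
  let I : Finset (V × V) := Finset.univ.filter fun p => p.1 ∈ T ∧ p.2 ∈ T ∧ G.Adj p.1 p.2
  have hI : Even I.card := by
    refine even_of_involution I Prod.swap ?_ ?_ ?_
    · rintro ⟨a, b⟩ h
      simp only [I, Finset.mem_filter, Finset.mem_univ, true_and, Prod.swap] at h ⊢
      exact ⟨h.2.1, h.1, h.2.2.symm⟩
    · simp
    · rintro ⟨a, b⟩ h h'
      simp only [I, Finset.mem_filter, Finset.mem_univ, true_and] at h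
      simp only [Prod.swap, Prod.mk.injEq] at h'
      exact h.2.2.ne h'.2
  have hsum : (crossing G T).card + I.card = 3 * T.card := by
    rw [← Finset.card_union_of_disjoint]
    · have e : crossing G T ∪ I = (T.sigma (fun v => G.neighborFinset v)).image
          (fun p => ((p.1, p.2) : V × V)) := by
        ext ⟨a, b⟩
        simp only [crossing, I, Finset.mem_union, Finset.mem_filter, Finset.mem_univ, true_and,
          Finset.mem_image, Finset.mem_sigma, mem_neighborFinset, Prod.mk.injEq, Sigma.exists]
        constructor
        · rintro (h | h)
          · exact ⟨a, b, ⟨h.1, h.2.2⟩, rfl, rfl⟩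
          · exact ⟨a, b, ⟨h.1, h.2.2⟩, rfl, rfl⟩
        · rintro ⟨a, b, ⟨h1, h2⟩, rfl, rfl⟩
          by_cases hb : b ∈ T
          · exact Or.inr ⟨h1, hb, h2⟩
          · exact Or.inl ⟨h1, hb, h2⟩
      rw [e, Finset.card_image_of_injective, Finset.card_sigma]
      · simp [hcubic, mul_comm]
      · rintro ⟨a, b⟩ ⟨c, d⟩ h
        simp only [Prod.mk.injEq] at h
        obtain ⟨rfl, rfl⟩ := h
        rfl
    · rw [Finset.disjoint_left]
      rintro ⟨a, b⟩ h1 h2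
      simp only [crossing, I, Finset.mem_filter, Finset.mem_univ, true_and] at h1 h2
      exact h1.2.1 h2.2.1
  rw [Nat.even_iff] at hI
  rw [Nat.odd_iff, Nat.odd_iff]
  omega

theorem crossing_ge_three (hcubic : ∀ v : V, G.degree v = 3)
    (hdel : ∀ v : V, (G.induce ({v}ᶜ : Set V)).Connected) (T : Finset V) (hT : Odd T.card) :
    3 ≤ (crossing G T).card := by
  have hodd := (crossing_parity G hcubic T).2 hT
  by_contra hlt
  have h1 : (crossing G T).card = 1 := by
    rw [Nat.odd_iff] at hodd; omega
  obtain ⟨⟨p, q⟩, hpq⟩ := Finset.card_eq_one.1 h1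
  have hmem : ∀ a b, a ∈ T → b ∉ T → G.Adj a b → a = p ∧ b = q := by
    intro a b ha hb hab
    have : (a, b) ∈ crossing G T := by simp [crossing, ha, hb, hab]
    rw [hpq] at this
    simpa using this
  have hp : (p, q) ∈ crossing G T := by rw [hpq]; simp
  simp only [crossing, Finset.mem_filter, Finset.mem_univ, true_and] at hp
  obtain ⟨hpT, hqT, hadj⟩ := hp
  by_cases hs : ∃ r ∈ T, r ≠ p
  · obtain ⟨r, hrT, hrp⟩ := hs
    have hqp : q ≠ p := fun h => hqT (h ▸ hpT)
    obtain ⟨w⟩ := (hdel p).preconnected ⟨r, by simpa using hrp⟩ ⟨q, by simpa using hqp⟩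
    have : ∀ (a b : ({p}ᶜ : Set V)), (G.induce ({p}ᶜ : Set V)).Walk a b → a.1 ∈ T → b.1 ∈ T := by
      intro a b w
      induction w with
      | nil => exact id
      | cons h _ ih =>
        intro ha
        apply ih
        by_contra hb
        rename_i u v _ _
        exact u.2 (hmem _ _ ha hb h).1
    exact hqT (this _ _ w hrT)
  · push Not at hs
    have hsub : (G.neighborFinset p).card ≤ ({q} : Finset V).card := by
      apply Finset.card_le_card
      intro b hb
      rw [mem_neighborFinset] at hb
      have hbT : b ∉ T := fun h => hb.ne (hs b h).symm
      simpa using (hmem p b hpT hbT hb).2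
    rw [card_neighborFinset_eq_degree, hcubic] at hsub
    simp at hsub

theorem goodW_third (hcubic : ∀ v : V, G.degree v = 3)
    (hdel : ∀ v : V, (G.induce ({v}ᶜ : Set V)).Connected) :
    GoodW (fun u v : V => if G.Adj u v then (1 / 3 : ℝ) else 0) where
  symm := by intro u v; simp [G.adj_comm]
  diag := by simp
  nonneg := by intro u v; split_ifs <;> norm_num
  sum := by
    intro u
    rw [← Finset.sum_filter, Finset.sum_const, ← neighborFinset_eq_filter,
      card_neighborFinset_eq_degree, hcubic]
    norm_num
  cut := by
    intro T hT
    have h3 := crossing_ge_three G hcubic hdel T hT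
    have : Cut (fun u v : V => if G.Adj u v then (1 / 3 : ℝ) else 0) T
        = (crossing G T).card * (1 / 3) := by
      unfold Cut
      rw [← Fintype.sum_prod_type' (f := fun u v : V => if u ∈ T ∧ v ∉ T then
        (if G.Adj u v then (1 / 3 : ℝ) else 0) else 0)]
      simp only [← ite_and, and_assoc]
      rw [← Finset.sum_filter, Finset.sum_const, nsmul_eq_mul]
      rfl
    rw [this]
    have : (3 : ℝ) ≤ (crossing G T).card := by exact_mod_cast h3
    linarith

/-- The matching subgraph of an involution. -/
def invSub (f : V → V) (h1 : ∀ v, f (f v) = v) (h3 : ∀ v, G.Adj v (f v)) : G.Subgraph where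
  verts := Set.univ
  Adj u v := f u = v
  adj_sub := by rintro u v rfl; exact h3 u
  edge_vert := by simp
  symm := ⟨by rintro u v rfl; exact h1 u⟩

theorem edge_image (T : Finset V) (R : V → V → Prop) [DecidableRel R] :
    {e : Sym2 V | e ∈ G.edgeSet ∧ ∃ p q : V, e = s(p, q) ∧ p ∈ T ∧ q ∉ T ∧ R p q}.ncard =
      ((crossing G T).filter fun p => R p.1 p.2).card := by
  rw [← Set.ncard_coe_finset, ← Set.InjOn.ncard_image (f := fun p : V × V => s(p.1, p.2))]
  · congr 1
    ext e
    simp only [Set.mem_ofPred_eq, Set.mem_image, Finset.mem_coe, Finset.mem_filter, crossing,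
      Finset.mem_univ, true_and, Prod.exists]
    constructor
    · rintro ⟨he, p, q, rfl, h1, h2, h3⟩
      exact ⟨p, q, ⟨⟨h1, h2, he⟩, h3⟩, rfl⟩
    · rintro ⟨p, q, ⟨⟨h1, h2, h⟩, h3⟩, rfl⟩
      exact ⟨h, p, q, rfl, h1, h2, h3⟩
  · rintro ⟨a, b⟩ h ⟨c, d⟩ h' hh
    simp only [Finset.coe_filter, crossing, Finset.mem_filter, Finset.mem_univ, true_and,
      Set.mem_ofPred_eq] at h h'
    simp only [Sym2.eq_iff] at hh
    rcases hh with ⟨rfl, rfl⟩ | ⟨rfl, rfl⟩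
    · rfl
    · exact absurd h.1.1 h'.1.2.1

end Main

/-- For a 2-connected cubic simple graph `G` there exist 3-cut perfect matchings
`M_1, …, M_k` and positive coefficients `λ_1, …, λ_k` summing to 1 such that every
edge receives total weight `1/3`. -/
theorem stmt3 {V : Type*} [Fintype V] [DecidableEq V]
    (G : SimpleGraph V) [DecidableRel G.Adj]
    (hcubic : ∀ v : V, G.degree v = 3)
    (hcard3 : 3 ≤ Fintype.card V)
    (hconn : G.Connected)
    (hdel : ∀ v : V, (G.induce ({v}ᶜ : Set V)).Connected) :
    ∃ (k : ℕ), 0 < k ∧ ∃ (M : Fin k → G.Subgraph) (lam : Fin k → ℝ),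
      (∀ i, (M i).IsPerfectMatching) ∧
      (∀ i, ∀ S : Set V, S.Nonempty → S ≠ Set.univ →
        {e | e ∈ G.edgeSet ∧ ∃ p q : V, e = s(p, q) ∧ p ∈ S ∧ q ∉ S}.ncard = 3 →
        ({e | e ∈ G.edgeSet ∧ ∃ p q : V, e = s(p, q) ∧ p ∈ S ∧ q ∉ S}
          ∩ (M i).edgeSet).ncard = 1) ∧
      (∀ i, 0 < lam i) ∧
      (∑ i, lam i = 1) ∧
      (∀ e ∈ G.edgeSet, ∑ i, Set.indicator {j : Fin k | e ∈ (M j).edgeSet} lam i = 1 / 3) := by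
  classical
  have hgood := goodW_third G hcubic hdel
  obtain ⟨ι, _, l, F, h1, h2, h3, h4⟩ := GoodW.dec _ _ rfl rfl hgood
  let ε := (Fintype.equivFin {i : ι // 0 < l i}).symm
  have hsub : ∀ g : ι → ℝ, (∀ i, l i = 0 → g i = 0) →
      ∑ i : Fin (Fintype.card {i : ι // 0 < l i}), g (ε i).1 = ∑ i, g i := by
    intro g hg
    rw [Equiv.sum_comp ε (fun i => g i.1)]
    rw [← Finset.sum_subtype (Finset.univ.filter fun i => 0 < l i) (by simp) g]
    rw [Finset.sum_filter]
    refine Finset.sum_congr rfl fun i _ => ?_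
    split_ifs with h
    · rfl
    · exact (hg i (le_antisymm (not_lt.1 h) (h1 i))).symm
  have hadj : ∀ i, 0 < l i → ∀ v, G.Adj v (F i v) := by
    intro i hi v
    by_contra hn
    have := h4 v (F i v)
    simp only [hn, if_false] at this
    rw [Finset.sum_eq_zero_iff_of_nonneg (fun j _ => by split_ifs <;> simp [h1])] at this
    have := this i (Finset.mem_univ _)
    simp at this
    linarith
  obtain ⟨v0⟩ := hconn.nonempty
  have htot : ∑ i, l i = 1 := by
    rw [← hgood.sum v0]
    simp_rw [← h4]
    rw [Finset.sum_comm]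
    simp
  have htot' : ∑ i : Fin (Fintype.card {i : ι // 0 < l i}), l (ε i).1 = 1 := by
    rw [hsub l (fun _ h => h), htot]
  refine ⟨Fintype.card {i : ι // 0 < l i}, ?_, fun i => invSub G (F (ε i).1) (h2 _)
    (hadj _ (ε i).2), fun i => l (ε i).1, ?_, ?_, fun i => (ε i).2, htot', ?_⟩
  · by_contra h
    have h0 : Fintype.card {i : ι // 0 < l i} = 0 := by omega
    have : IsEmpty (Fin (Fintype.card {i : ι // 0 < l i})) := by rw [h0]; infer_instance
    rw [Finset.univ_eq_empty, Finset.sum_empty] at htot'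
    exact zero_ne_one htot'
  · intro i
    rw [Subgraph.isPerfectMatching_iff]
    intro v
    exact ⟨F (ε i).1 v, rfl, fun w hw => Eq.symm hw⟩
  · intro i S _ _ hS3
    obtain ⟨T, rfl⟩ : ∃ T : Finset V, S = (T : Set V) := ⟨S.toFinset, by simp⟩
    have c3 : (crossing G T).card = 3 := by
      have := edge_image G T (fun _ _ => True)
      simp only [and_true, Finset.filter_true] at this
      rw [← this]
      simpa using hS3
    have hTodd : Odd T.card := (crossing_parity G hcubic T).1 (by rw [c3]; decide)
    let N : ι → ℕ := fun i => ((crossing G T).filter fun p => F i p.1 = p.2).card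
    have hset : ({e | e ∈ G.edgeSet ∧ ∃ p q : V, e = s(p, q) ∧ p ∈ (T : Set V) ∧ q ∉ (T : Set V)}
        ∩ (invSub G (F (ε i).1) (h2 _) (hadj _ (ε i).2)).edgeSet).ncard = N (ε i).1 := by
      refine Eq.trans ?_ (edge_image G T (fun u v => F (ε i).1 u = v))
      congr 1
      ext e
      constructor
      · rintro ⟨⟨he, p, q, rfl, hp, hq⟩, hM⟩
        exact ⟨he, p, q, rfl, hp, hq, hM⟩
      · rintro ⟨he, p, q, rfl, hp, hq, hM⟩
        exact ⟨⟨he, p, q, rfl, hp, hq⟩, hM⟩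
    rw [hset]
    have hN1 : ∀ j, 0 < l j → 1 ≤ N j := by
      intro j hj
      by_contra hlt
      have h0 : N j = 0 := by omega
      rw [Finset.card_eq_zero, Finset.filter_eq_empty_iff] at h0
      have : Even T.card := by
        refine even_of_involution T (F j) ?_ (fun a _ => h2 j a) (fun a _ => h3 j a)
        intro a ha
        by_contra hb
        exact h0 (x := (a, F j a)) (by simp [crossing, ha, hb, hadj j hj a]) rfl
      rw [← Nat.not_even_iff_odd] at hTodd
      exact hTodd this
    have hNsum : ∑ j, l j * N j = 1 := by
      have : ∀ j, l j * N j = ∑ p ∈ crossing G T, if F j p.1 = p.2 then l j else 0 := by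
        intro j
        rw [← Finset.sum_filter, Finset.sum_const, nsmul_eq_mul, mul_comm]
      simp_rw [this]
      rw [Finset.sum_comm]
      have : ∀ p ∈ crossing G T, (∑ j, if F j p.1 = p.2 then l j else 0) = 1 / 3 := by
        intro p hp
        rw [h4]
        simp only [crossing, Finset.mem_filter] at hp
        simp [hp.2.2.2]
      rw [Finset.sum_congr rfl this, Finset.sum_const, c3]
      norm_num
    have hz : ∑ j, l j * ((N j : ℝ) - 1) = 0 := by
      simp_rw [mul_sub, mul_one]
      rw [Finset.sum_sub_distrib, hNsum, htot, sub_self]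
    rw [Finset.sum_eq_zero_iff_of_nonneg] at hz
    · have := hz (ε i).1 (Finset.mem_univ _)
      rcases mul_eq_zero.1 this with h | h
      · exact absurd h (ε i).2.ne'
      · have : (N (ε i).1 : ℝ) = 1 := by linarith
        exact_mod_cast this
    · intro j _
      rcases (h1 j).eq_or_lt with h | h
      · simp [← h]
      · have : (1 : ℝ) ≤ N j := by exact_mod_cast hN1 j h
        exact mul_nonneg h.le (by linarith)
  · intro e he
    induction e using Sym2.ind with
    | _ a b =>
    have hab : G.Adj a b := he
    have e1 := hsub (fun i => if F i a = b then l i else 0) (fun i hi => by simp [hi])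
    rw [h4] at e1
    simp only [hab, if_true] at e1
    rw [← e1]
    refine Finset.sum_congr rfl fun i _ => ?_
    rw [Set.indicator_apply]
    exact if_congr Iff.rfl rfl rfl
end
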